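/- arXiv:2212.07122 — 3 statements merged into one kernel-verified Lean document; each statement's English description precedes it below -/
import Mathlib

section
/- Let 𝔞 be an ideal of R and M an 𝔞-relative Cohen-Macaulay R-module with M ≠ 𝔞M. Then for every minimal element 𝔭 of Supp_R(M/𝔞M), the localization M_𝔭 is a Cohen-Macaulay R_𝔭-module. -/
open CategoryTheory Opposite
open scoped TensorProduct

universe u

variable (R : Type u) [CommRing R]

/-- The Ext module `Ext^i_R(R/a, M)` as an object of `ModuleCat R`. -/
noncomputable def relExt (a : Ideal R) (i : ℕ)
    (M : Type u) [AddCommGroup M] [Module R M] : ModuleCat R :=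
  ((Ext R (ModuleCat R) i).obj (op (ModuleCat.of R (R ⧸ a)))).obj (ModuleCat.of R M)

/-- `grade(a, M) = inf { i | Ext^i_R(R/a, M) ≠ 0 }`. -/
noncomputable def rgrade (a : Ideal R) (M : Type u) [AddCommGroup M] [Module R M] : ℕ :=
  sInf {i | Nontrivial (relExt R a i M)}

/-- The local cohomology module `H^i_a(M)` as an object of `ModuleCat R`. -/
noncomputable def localCoh (a : Ideal R) (i : ℕ)
    (M : Type u) [AddCommGroup M] [Module R M] : ModuleCat R :=
  (localCohomology a i).obj (ModuleCat.of R M)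

/-- `cd(a, M) = sup { i | H^i_a(M) ≠ 0 }` (cohomological dimension). -/
noncomputable def rcd (a : Ideal R) (M : Type u) [AddCommGroup M] [Module R M] : ℕ :=
  sSup {i | Nontrivial (localCoh R a i M)}

/-- `M` is `a`-relative Cohen-Macaulay: `M = aM`, or `M ≠ aM` and
`grade(a,M) = cd(a,M)`. -/
def IsRelCM (a : Ideal R) (M : Type u) [AddCommGroup M] [Module R M] : Prop :=
  (a • (⊤ : Submodule R M) = ⊤) ∨
    (a • (⊤ : Submodule R M) ≠ ⊤ ∧ rgrade R a M = rcd R a M)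

/-- `ara(a, M)`: the arithmetic rank of `a` with respect to `M`. -/
noncomputable def ara (a : Ideal R) (M : Type u) [AddCommGroup M] [Module R M] : ℕ :=
  sInf {n | ∃ x : Fin n → R,
    (Ideal.span (Set.range x) + Module.annihilator R M).radical
      = (a + Module.annihilator R M).radical}

/-- Projective dimension of `M`, characterized by Ext-vanishing, valued in `ℕ∞`. -/
noncomputable def rpd (M : Type u) [AddCommGroup M] [Module R M] : ℕ∞ :=
  sSup ((fun i : ℕ => (i : ℕ∞)) '' {i : ℕ | ∃ N : ModuleCat R,
    Nontrivial (((Ext R (ModuleCat R) i).obj (op (ModuleCat.of R M))).obj N)})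

/-- Injective dimension of `M`, characterized by Ext-vanishing, valued in `ℕ∞`. -/
noncomputable def rid (M : Type u) [AddCommGroup M] [Module R M] : ℕ∞ :=
  sSup ((fun i : ℕ => (i : ℕ∞)) '' {i : ℕ | ∃ N : ModuleCat R,
    Nontrivial (((Ext R (ModuleCat R) i).obj (op N)).obj (ModuleCat.of R M))})

/-- The `a`-relative injective dimension `a-id_R M = sup{i | Ext^i(R/a, M) ≠ 0}`,
valued in `ℕ∞`. -/
noncomputable def raid (a : Ideal R) (M : Type u) [AddCommGroup M] [Module R M] : ℕ∞ :=
  sSup ((fun i : ℕ => (i : ℕ∞)) '' {i : ℕ | Nontrivial (relExt R a i M)})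

/-- `μ(a)`: the minimal number of generators of the ideal `a`. -/
noncomputable def mu (a : Ideal R) : ℕ :=
  sInf {n | ∃ s : Finset R, s.card = n ∧ Ideal.span (↑s : Set R) = a}

/-- `R` is `a`-relative regular: `a` is generated by an `R`-regular sequence of
length `cd(a,R)`. -/
def IsRelRegularRing (a : Ideal R) : Prop :=
  ∃ rs : List R, RingTheory.Sequence.IsRegular R rs ∧ rs.length = rcd R a R ∧
    Ideal.ofList rs = a

/-- `M` is an `a`-relative regular module: `M = aM`, or `M ≠ aM` and `a` is generated by
a sequence of length `cd(a,R)` that is both an `M`-regular and an `R`-regular sequence. -/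
def IsRelRegularMod (a : Ideal R) (M : Type u) [AddCommGroup M] [Module R M] : Prop :=
  (a • (⊤ : Submodule R M) = ⊤) ∨
    (a • (⊤ : Submodule R M) ≠ ⊤ ∧ ∃ rs : List R, rs.length = rcd R a R ∧
      Ideal.ofList rs = a ∧ RingTheory.Sequence.IsRegular M rs ∧
      RingTheory.Sequence.IsRegular R rs)

section P1
variable {A : Type u} [CommRing A]

noncomputable def lyMap {K L : ChainComplex (ModuleCat.{u} A) ℕ} (φ : K ⟶ L) (Y : ModuleCat.{u} A) :
    L.linearYonedaObj A Y ⟶ K.linearYonedaObj A Y :=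
  (HomologicalComplex.unopFunctor _ _).map
    ((((linearYoneda A (ModuleCat.{u} A)).obj Y).rightOp.mapHomologicalComplex _).map φ).op

lemma lyMap_f {K L : ChainComplex (ModuleCat.{u} A) ℕ} (φ : K ⟶ L) (Y : ModuleCat.{u} A) (n : ℕ)
    (h : L.X n ⟶ Y) : (lyMap φ Y).f n h = (φ.f n ≫ h : K.X n ⟶ Y) := rfl

lemma gen_nat {C : Type*} [Category C] {E' E H' H : C} {L' L : Cᵒᵖ} (a' : op E' ≅ L')
    (a : op E ≅ L) (b' : L' ≅ op H') (b : L ≅ op H) (m : E ⟶ E') (l : L' ⟶ L) (h : H ⟶ H')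
    (h1 : a'.inv ≫ m.op = l ≫ a.inv) (h2 : l ≫ b.hom = b'.hom ≫ h.op) :
    m ≫ (a'.unop.symm ≪≫ b'.unop.symm).hom = (a.unop.symm ≪≫ b.unop.symm).hom ≫ h := by
  apply Quiver.Hom.op_inj
  have h2'' : h.op ≫ b.inv = b'.inv ≫ l := by
    rw [Iso.comp_inv_eq, Category.assoc, Iso.eq_inv_comp, h2]
  simp [h1, reassoc_of% h2'']

lemma isoExt_nat {X' X Y : ModuleCat.{u} A} (g : X' ⟶ X) (P' : ProjectiveResolution X')
    (P : ProjectiveResolution X) (φ : ProjectiveResolution.Hom P' P g) (n : ℕ) :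
    ((Ext A (ModuleCat.{u} A) n).map g.op).app Y ≫ (P'.isoExt n Y).hom =
      (P.isoExt n Y).hom ≫ HomologicalComplex.homologyMap (lyMap φ.hom Y) n := by
  have h1 := ProjectiveResolution.isoLeftDerivedObj_inv_naturality g P' P φ.hom
    φ.hom_f_zero_comp_π_f_zero
    ((linearYoneda A (ModuleCat.{u} A)).obj Y).rightOp n
  have h2 := HomologicalComplex.homologyOp_hom_naturality (lyMap φ.hom Y) n
  let F := ((linearYoneda A (ModuleCat.{u} A)).obj Y).rightOp
  let b' : ((F.mapHomologicalComplex (ComplexShape.down ℕ)).obj P'.complex).homology n ≅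
     op ((P'.complex.linearYonedaObj A Y).homology n) :=
     HomologicalComplex.homologyOp (P'.complex.linearYonedaObj A Y) n
  let b : ((F.mapHomologicalComplex (ComplexShape.down ℕ)).obj P.complex).homology n ≅
     op ((P.complex.linearYonedaObj A Y).homology n) :=
     HomologicalComplex.homologyOp (P.complex.linearYonedaObj A Y) n
  have h2' : (F.mapHomologicalComplex (ComplexShape.down ℕ) ⋙
      HomologicalComplex.homologyFunctor _ _ n).map φ.hom ≫ b.hom = b'.hom ≫
        (HomologicalComplex.homologyMap (lyMap φ.hom Y) n).op := h2
  exact gen_nat (C := ModuleCat.{u} A) (E := ((Ext A (ModuleCat.{u} A) n).obj (op X)).obj Y)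
    (E' := ((Ext A (ModuleCat.{u} A) n).obj (op X')).obj Y)
    (P'.isoLeftDerivedObj F n) (P.isoLeftDerivedObj F n) b' b
    (((Ext A (ModuleCat.{u} A) n).map g.op).app Y) _ _ h1 h2'

/-- the old Ext element `z` is represented by the cocycle `f` -/
def OERep {X Y : ModuleCat.{u} A} (P : ProjectiveResolution X) (n : ℕ)
    (z : ((Ext A (ModuleCat.{u} A) n).obj (op X)).obj Y) (f : P.complex.X n ⟶ Y) : Prop :=
  ∃ c : (P.complex.linearYonedaObj A Y).cycles n,
    (P.complex.linearYonedaObj A Y).iCycles n c = f ∧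
    (P.complex.linearYonedaObj A Y).homologyπ n c = (P.isoExt n Y).hom z

lemma OERep.exists {X Y : ModuleCat.{u} A} (P : ProjectiveResolution X) (n : ℕ)
    (z : ((Ext A (ModuleCat.{u} A) n).obj (op X)).obj Y) :
    ∃ f, P.complex.d (n+1) n ≫ f = 0 ∧ OERep P n z f := by
  obtain ⟨c, hc⟩ := (ModuleCat.epi_iff_surjective _).1
    (inferInstance : (Epi ((P.complex.linearYonedaObj A Y).homologyπ n))) ((P.isoExt n Y).hom z)
  refine ⟨(P.complex.linearYonedaObj A Y).iCycles n c, ?_, c, rfl, hc⟩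
  have := (P.complex.linearYonedaObj A Y).iCycles_d n (n+1)
  exact ConcreteCategory.congr_hom this c

lemma OERep.exists' {X Y : ModuleCat.{u} A} (P : ProjectiveResolution X) (n : ℕ)
    (f : P.complex.X n ⟶ Y) (hf : P.complex.d (n+1) n ≫ f = 0) :
    ∃ z : ((Ext A (ModuleCat.{u} A) n).obj (op X)).obj Y, OERep P n z f := by
  let c := HomologicalComplex.cyclesMk (P.complex.linearYonedaObj A Y) (i := n) f (n+1) (by simp) hf
  refine ⟨(P.isoExt n Y).inv ((P.complex.linearYonedaObj A Y).homologyπ n c), c, ?_, ?_⟩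
  · exact HomologicalComplex.i_cyclesMk (P.complex.linearYonedaObj A Y) (i := n) f (n+1) (by simp) hf
  · simp

lemma OERep.map {X' X Y : ModuleCat.{u} A} (g : X' ⟶ X) {P' : ProjectiveResolution X'}
    {P : ProjectiveResolution X} (φ : ProjectiveResolution.Hom P' P g) (n : ℕ)
    (z : ((Ext A (ModuleCat.{u} A) n).obj (op X)).obj Y) (f : P.complex.X n ⟶ Y)
    (h : OERep P n z f) : OERep P' n (((Ext A (ModuleCat.{u} A) n).map g.op).app Y z) (φ.hom.f n ≫ f) := by
  obtain ⟨c, rfl, h2⟩ := h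
  refine ⟨HomologicalComplex.cyclesMap (lyMap φ.hom Y) n c, ?_, ?_⟩
  · exact ConcreteCategory.congr_hom (HomologicalComplex.cyclesMap_i (lyMap φ.hom Y) n) c
  · have h3 := ConcreteCategory.congr_hom (HomologicalComplex.homologyπ_naturality (lyMap φ.hom Y) n) c
    have h4 := ConcreteCategory.congr_hom (isoExt_nat (Y := Y) g P' P φ n) z
    simp only [ModuleCat.comp_apply] at h3 h4
    rw [h4, ← h3, h2]

lemma OERep.zero_iff_succ {X Y : ModuleCat.{u} A} (P : ProjectiveResolution X) (n : ℕ)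
    (z : ((Ext A (ModuleCat.{u} A) (n+1)).obj (op X)).obj Y) (f : P.complex.X (n+1) ⟶ Y)
    (h : OERep P (n+1) z f) : z = 0 ↔ ∃ g : P.complex.X n ⟶ Y, P.complex.d (n+1) n ≫ g = f := by
  obtain ⟨c, rfl, h2⟩ := h
  have h3 : z = 0 ↔ (P.complex.linearYonedaObj A Y).homologyπ (n+1) c = 0 := by
    rw [h2]
    refine ⟨fun h => by simp [h], fun h => ?_⟩
    simpa using congrArg (P.isoExt (n+1) Y).inv h
  rw [h3]
  have ex := ShortComplex.exact_of_g_is_cokernel (.mk _ _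
    ((P.complex.linearYonedaObj A Y).toCycles_comp_homologyπ n (n+1)))
    ((P.complex.linearYonedaObj A Y).homologyIsCokernel n (n+1) (by simp))
  rw [ShortComplex.moduleCat_exact_iff] at ex
  have ht := (P.complex.linearYonedaObj A Y).toCycles_i n (n+1)
  constructor
  · intro h
    obtain ⟨g, hg⟩ := ex c h
    refine ⟨g, ?_⟩
    have := ConcreteCategory.congr_hom ht g
    rw [ModuleCat.comp_apply] at this
    exact this.symm.trans (congrArg _ hg)
  · rintro ⟨g, hg⟩
    have h5 : (P.complex.linearYonedaObj A Y).toCycles n (n+1) g = c := by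
      apply (ModuleCat.mono_iff_injective _).1
        (inferInstance : (Mono ((P.complex.linearYonedaObj A Y).iCycles (n+1))))
      have := ConcreteCategory.congr_hom ht g
      exact this.trans hg
    rw [← h5]
    exact ConcreteCategory.congr_hom ((P.complex.linearYonedaObj A Y).toCycles_comp_homologyπ n (n+1)) g

lemma OERep.zero_iff_zero {X Y : ModuleCat.{u} A} (P : ProjectiveResolution X)
    (z : ((Ext A (ModuleCat.{u} A) 0).obj (op X)).obj Y) (f : P.complex.X 0 ⟶ Y)
    (h : OERep P 0 z f) : z = 0 ↔ f = 0 := by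
  obtain ⟨c, rfl, h2⟩ := h
  have h3 : z = 0 ↔ (P.complex.linearYonedaObj A Y).homologyπ 0 c = 0 := by
    rw [h2]
    refine ⟨fun h => by simp [h], fun h => ?_⟩
    simpa using congrArg (P.isoExt 0 Y).inv h
  have h4 : IsIso ((P.complex.linearYonedaObj A Y).homologyπ 0) :=
    HomologicalComplex.isIso_homologyπ _ _ 0 rfl
      (HomologicalComplex.shape _ _ _ (by simp))
  have h5 := (ModuleCat.mono_iff_injective _).1
        (inferInstance : (Mono ((P.complex.linearYonedaObj A Y).iCycles 0)))
  have h6 := (ModuleCat.mono_iff_injective _).1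
        (inferInstance : (Mono ((P.complex.linearYonedaObj A Y).homologyπ 0)))
  rw [h3]
  constructor
  · intro h
    have : c = 0 := h6 (by rw [h, map_zero])
    rw [this]; exact map_zero _
  · intro h
    have : c = 0 := h5 (by rw [map_zero]; exact h)
    rw [this, map_zero]

lemma extMk_zero_iff_zero {X Y : ModuleCat.{u} A} (P : ProjectiveResolution X)
    (f : P.complex.X 0 ⟶ Y) (hf : P.complex.d 1 0 ≫ f = 0) :
    P.extMk f 1 rfl hf = 0 ↔ f = 0 := by
  constructor
  · intro h
    rw [← P.extEquivCohomologyClass.apply_eq_iff_eq,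
      ProjectiveResolution.extEquivCohomologyClass_extMk,
      ProjectiveResolution.extEquivCohomologyClass_zero,
      CochainComplex.HomComplex.CohomologyClass.mk_eq_zero_iff,
      CochainComplex.HomComplex.Cocycle.toSingleMk_mem_coboundaries_iff _ _ _ _ _ 1 (by simp)] at h
    obtain ⟨β, hβ⟩ := h
    have hb : β = 0 := (P.cochainComplex.isZero_of_isStrictlyLE 0 1 (by simp)).eq_of_src _ _
    rw [hb, Limits.comp_zero] at hβ
    rw [← cancel_epi (P.cochainComplexXIso (-(0:ℕ)) 0 rfl).hom, Limits.comp_zero]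
    exact hβ.symm
  · rintro rfl
    exact P.extMk_zero _ _

lemma OERep.zero_iff {X Y : ModuleCat.{u} A} (P : ProjectiveResolution X) (n : ℕ)
    (z : ((Ext A (ModuleCat.{u} A) n).obj (op X)).obj Y) (f : P.complex.X n ⟶ Y)
    (h : OERep P n z f) (hf : P.complex.d (n+1) n ≫ f = 0) :
    z = 0 ↔ P.extMk f (n+1) rfl hf = 0 := by
  cases n with
  | zero => rw [OERep.zero_iff_zero P z f h, extMk_zero_iff_zero]
  | succ n => rw [OERep.zero_iff_succ P n z f h, P.extMk_eq_zero_iff f _ rfl hf n rfl]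

lemma OERep.map_zero_iff {X Y : ModuleCat.{u} A} (P : ProjectiveResolution X) (n : ℕ)
    (z : ((Ext A (ModuleCat.{u} A) n).obj (op X)).obj Y) (f : P.complex.X n ⟶ Y)
    (h : OERep P n z f) (hf : P.complex.d (n+1) n ≫ f = 0) (X' : ModuleCat.{u} A) (g : X' ⟶ X) :
    ((Ext A (ModuleCat.{u} A) n).map g.op).app Y z = 0 ↔
      (Abelian.Ext.mk₀ g).comp (P.extMk f (n+1) rfl hf) (zero_add n) = 0 := by
  let P' := projectiveResolution X'
  let φ : ProjectiveResolution.Hom P' P g := ⟨ProjectiveResolution.lift g P' P,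
    ProjectiveResolution.lift_commutes_zero g P' P⟩
  rw [ProjectiveResolution.mk₀_comp_extMk f _ rfl hf φ]
  exact OERep.zero_iff P' n _ _ (OERep.map g φ n z f h) _

lemma cmp_old {X Y : ModuleCat.{u} A} (n : ℕ)
    (z : ((Ext A (ModuleCat.{u} A) n).obj (op X)).obj Y) : ∃ e : Abelian.Ext X Y n,
    ∀ (X' : ModuleCat.{u} A) (g : X' ⟶ X), ((Ext A (ModuleCat.{u} A) n).map g.op).app Y z = 0 ↔
      (Abelian.Ext.mk₀ g).comp e (zero_add n) = 0 := by
  obtain ⟨f, hf, h⟩ := OERep.exists (projectiveResolution X) n z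
  exact ⟨_, OERep.map_zero_iff _ n z f h hf⟩

lemma cmp_new {X Y : ModuleCat.{u} A} (n : ℕ) (e : Abelian.Ext X Y n) :
    ∃ z : ((Ext A (ModuleCat.{u} A) n).obj (op X)).obj Y,
    ∀ (X' : ModuleCat.{u} A) (g : X' ⟶ X), ((Ext A (ModuleCat.{u} A) n).map g.op).app Y z = 0 ↔
      (Abelian.Ext.mk₀ g).comp e (zero_add n) = 0 := by
  obtain ⟨f, hf, rfl⟩ := (projectiveResolution X).extMk_surjective e (n+1) rfl
  obtain ⟨z, h⟩ := OERep.exists' (projectiveResolution X) n f hf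
  exact ⟨z, OERep.map_zero_iff _ n z f h hf⟩

lemma cmp_subsingleton {X Y : ModuleCat.{u} A} (n : ℕ) :
    Subsingleton (((Ext A (ModuleCat.{u} A) n).obj (op X)).obj Y) ↔
      ∀ e : Abelian.Ext X Y n, e = 0 := by
  constructor
  · intro _ e
    obtain ⟨z, hz⟩ := cmp_new n e
    simpa using (hz X (𝟙 X)).1 (by rw [Subsingleton.elim z 0, map_zero])
  · intro h
    suffices ∀ z : ((Ext A (ModuleCat.{u} A) n).obj (op X)).obj Y, z = 0 from
      ⟨fun a b => (this a).trans (this b).symm⟩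
    intro z
    obtain ⟨e, he⟩ := cmp_old n z
    simpa using (he X (𝟙 X)).2 (by rw [h e, Abelian.Ext.comp_zero])
end P1

section P2
variable {A : Type u} [CommRing A]

/-- the projection `A/I → A/J` -/
noncomputable def qm {I J : Ideal A} (h : I ≤ J) :
    ModuleCat.of A (A ⧸ I) ⟶ ModuleCat.of A (A ⧸ J) :=
  ModuleCat.ofHom (Submodule.mapQ I J LinearMap.id h)

/-- vanishing of the colimit of `Ext^i(A/J_n, N)` -/
def VV (J : ℕ → Ideal A) (i : ℕ) (N : ModuleCat.{u} A) : Prop :=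
  ∀ (n : ℕ) (e : Abelian.Ext (ModuleCat.of A (A ⧸ J n)) N i),
    ∃ l, n ≤ l ∧ ∃ h : J l ≤ J n, (Abelian.Ext.mk₀ (qm h)).comp e (zero_add i) = 0

open Limits in
lemma localCoh_subsingleton_imp (a : Ideal A) (i : ℕ) (M : Type u) [AddCommGroup M] [Module A M]
    (h : Subsingleton (localCoh A a i M)) : VV (fun n => a ^ n) i (ModuleCat.of A M) := by
  intro n e
  obtain ⟨z, hz⟩ := cmp_new i e
  have := localCohomology.hasColimitDiagram.{u, 0} (localCohomology.idealPowersDiagram a) i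
  have hpf : PreservesFilteredColimitsOfSize.{0, 0} (forget (ModuleCat.{u} A)) :=
    preservesFilteredColimitsOfSize_shrink.{0, u, 0, u} _
  let D := localCohomology.diagram (localCohomology.idealPowersDiagram a) i
  have hpf2 : PreservesColimitsOfShape ℕᵒᵖᵒᵖ (forget (ModuleCat.{u} A)) := hpf.1 _
  let F := D ⋙ (evaluation _ _).obj (ModuleCat.of A M)
  have h' : Subsingleton ((colimit D).obj (ModuleCat.of A M)) := h
  have hs : Subsingleton (colimit F : ModuleCat A) :=
    ((colimitObjIsoColimitCompEvaluation D (ModuleCat.of A M)).toLinearEquiv.toEquiv.symm.subsingleton)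
  have hz0 : colimit.ι F (op (op n)) z = 0 := Subsingleton.elim _ _
  obtain ⟨j, f, hf⟩ := Concrete.colimit_rep_eq_zero A F (op (op n)) z hz0
  have hnl : n ≤ j.unop.unop := f.unop.unop.down.down
  refine ⟨j.unop.unop, hnl, Ideal.pow_le_pow_right hnl, ?_⟩
  rw [← hz]
  exact hf

open Limits in
lemma localCoh_subsingleton_of (a : Ideal A) (i : ℕ) (M : Type u) [AddCommGroup M] [Module A M]
    (h : VV (fun n => a ^ n) i (ModuleCat.of A M)) : Subsingleton (localCoh A a i M) := by
  have := localCohomology.hasColimitDiagram.{u, 0} (localCohomology.idealPowersDiagram a) i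
  have hpf : PreservesFilteredColimitsOfSize.{0, 0} (forget (ModuleCat.{u} A)) :=
    preservesFilteredColimitsOfSize_shrink.{0, u, 0, u} _
  let D := localCohomology.diagram (localCohomology.idealPowersDiagram a) i
  have hpf2 : PreservesColimitsOfShape ℕᵒᵖᵒᵖ (forget (ModuleCat.{u} A)) := hpf.1 _
  let F := D ⋙ (evaluation _ _).obj (ModuleCat.of A M)
  suffices hs : Subsingleton (colimit F : ModuleCat A) from
    (colimitObjIsoColimitCompEvaluation D (ModuleCat.of A M)).toLinearEquiv.toEquiv.subsingleton
  suffices ∀ z : (colimit F : ModuleCat A), z = 0 from ⟨fun a b => (this a).trans (this b).symm⟩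
  intro z
  obtain ⟨j, y, rfl⟩ := Concrete.colimit_exists_rep F z
  obtain ⟨e, he⟩ := cmp_old i y
  obtain ⟨l, hl, hl', hv⟩ := h j.unop.unop e
  let f : j ⟶ op (op l) := (homOfLE hl).op.op
  have h1 : F.map f y = 0 := (he _ (qm hl')).2 hv
  have := ConcreteCategory.congr_hom (colimit.w F f) y
  rw [← this, ModuleCat.comp_apply, h1, map_zero]
end P2

section P3
variable {A : Type u} [CommRing A]

/-- pullback of Ext classes -/
noncomputable def pb {X X' Y : ModuleCat.{u} A} {i : ℕ} (f : X ⟶ X') (e : Abelian.Ext X' Y i) :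
    Abelian.Ext X Y i := (Abelian.Ext.mk₀ f).comp e (zero_add i)

/-- pushforward of Ext classes -/
noncomputable def pf {X Y Y' : ModuleCat.{u} A} {i : ℕ} (e : Abelian.Ext X Y i) (g : Y ⟶ Y') :
    Abelian.Ext X Y' i := e.comp (Abelian.Ext.mk₀ g) (add_zero i)

section
variable {X X' X'' Y Y' Y'' : ModuleCat.{u} A} {i : ℕ}
lemma pb_pb (f : X ⟶ X') (g : X' ⟶ X'') (e : Abelian.Ext X'' Y i) :
    pb f (pb g e) = pb (f ≫ g) e := by
  simp [pb]
lemma pf_pf (f : Y ⟶ Y') (g : Y' ⟶ Y'') (e : Abelian.Ext X Y i) :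
    pf (pf e f) g = pf e (f ≫ g) := by
  simp [pf]
lemma pb_pf (f : X ⟶ X') (g : Y ⟶ Y') (e : Abelian.Ext X' Y i) :
    pb f (pf e g) = pf (pb f e) g := by
  simp [pb, pf]
@[simp] lemma pb_zero (f : X ⟶ X') : pb f (0 : Abelian.Ext X' Y i) = 0 := by simp [pb]
@[simp] lemma zero_pb (e : Abelian.Ext X' Y i) : pb (0 : X ⟶ X') e = 0 := by simp [pb]
@[simp] lemma pf_zero (f : Y ⟶ Y') : pf (0 : Abelian.Ext X Y i) f = 0 := by simp [pf]
@[simp] lemma zero_pf (e : Abelian.Ext X Y i) : pf e (0 : Y ⟶ Y') = 0 := by simp [pf]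
@[simp] lemma pb_id (e : Abelian.Ext X Y i) : pb (𝟙 X) e = e := by simp [pb]
@[simp] lemma pf_id (e : Abelian.Ext X Y i) : pf e (𝟙 Y) = e := by simp [pf]
lemma pb_add (f : X ⟶ X') (e e' : Abelian.Ext X' Y i) : pb f (e + e') = pb f e + pb f e' := by
  simp [pb]
lemma pb_sub (f : X ⟶ X') (e e' : Abelian.Ext X' Y i) : pb f (e - e') = pb f e - pb f e' := by
  rw [eq_sub_iff_add_eq, ← pb_add, sub_add_cancel]
lemma pf_add (f : Y ⟶ Y') (e e' : Abelian.Ext X Y i) : pf (e + e') f = pf e f + pf e' f := by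
  simp [pf]
lemma pb_smul (f : X ⟶ X') (r : A) (e : Abelian.Ext X' Y i) : pb f (r • e) = r • pb f e := by
  simp [pb]
lemma pf_smul (f : Y ⟶ Y') (r : A) (e : Abelian.Ext X Y i) : pf (r • e) f = r • pf e f := by
  simp [pf]
lemma smul_pb (f : X ⟶ X') (r : A) (e : Abelian.Ext X' Y i) : pb (r • f) e = r • pb f e := by
  rw [pb, Abelian.Ext.mk₀_smul]; simp [pb]
lemma smul_pf (f : Y ⟶ Y') (r : A) (e : Abelian.Ext X Y i) : pf e (r • f) = r • pf e f := by
  rw [pf, Abelian.Ext.mk₀_smul]; simp [pf]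
lemma pf_sum {ι : Type*} (s : Finset ι) (f : ι → (Y ⟶ Y')) (e : Abelian.Ext X Y i) :
    pf e (∑ j ∈ s, f j) = ∑ j ∈ s, pf e (f j) := by
  classical
  induction s using Finset.induction_on with
  | empty => simp
  | insert a s ha ih =>
    rw [Finset.sum_insert ha, Finset.sum_insert ha, ← ih]
    simp [pf, Abelian.Ext.mk₀_add]
lemma smul_eq_zero_left (r : A) (h : ∀ x : X, r • x = 0) (e : Abelian.Ext X Y i) : r • e = 0 := by
  have : r • 𝟙 X = 0 := by ext x; exact h x
  rw [← pb_id e, ← smul_pb, this, zero_pb]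
lemma smul_eq_zero_right (r : A) (h : ∀ x : Y, r • x = 0) (e : Abelian.Ext X Y i) : r • e = 0 := by
  have : r • 𝟙 Y = 0 := by ext x; exact h x
  rw [← pf_id e, ← smul_pf, this, zero_pf]
lemma qm_comp {I J K : Ideal A} (h : I ≤ J) (h' : J ≤ K) : qm h ≫ qm h' = qm (h.trans h') := by
  ext
  rfl
end

section LES
variable {S S' : ShortComplex (ModuleCat.{u} A)} (hS : S.ShortExact) (hS' : S'.ShortExact)

/-- connecting map, contravariant -/
noncomputable def dc {Y : ModuleCat.{u} A} {i : ℕ} (e : Abelian.Ext S.X₁ Y i) :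
    Abelian.Ext S.X₃ Y (i+1) := hS.extClass.comp e (add_comm 1 i)
/-- connecting map, covariant -/
noncomputable def dv {X : ModuleCat.{u} A} {i : ℕ} (e : Abelian.Ext X S.X₃ i) :
    Abelian.Ext X S.X₁ (i+1) := e.comp hS.extClass rfl

include hS in
lemma contra_ex2 {Y : ModuleCat.{u} A} {i : ℕ} (e : Abelian.Ext S.X₂ Y i) (h : pb S.f e = 0) :
    ∃ e', pb S.g e' = e := Abelian.Ext.contravariant_sequence_exact₂ hS Y e h
lemma contra_ex3 {Y : ModuleCat.{u} A} {i : ℕ} (e : Abelian.Ext S.X₃ Y (i+1)) (h : pb S.g e = 0) :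
    ∃ e', dc hS e' = e := Abelian.Ext.contravariant_sequence_exact₃ hS Y e h (add_comm 1 i)
lemma contra_ex1 {Y : ModuleCat.{u} A} {i : ℕ} (e : Abelian.Ext S.X₁ Y i) (h : dc hS e = 0) :
    ∃ e', pb S.f e' = e := Abelian.Ext.contravariant_sequence_exact₁ hS Y e (add_comm 1 i) h
include hS in
lemma cov_ex2 {X : ModuleCat.{u} A} {i : ℕ} (e : Abelian.Ext X S.X₂ i) (h : pf e S.g = 0) :
    ∃ e', pf e' S.f = e := Abelian.Ext.covariant_sequence_exact₂ X hS e h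
lemma cov_ex3 {X : ModuleCat.{u} A} {i : ℕ} (e : Abelian.Ext X S.X₃ i) (h : dv hS e = 0) :
    ∃ e', pf e' S.g = e := Abelian.Ext.covariant_sequence_exact₃ X hS e rfl h
lemma cov_ex1 {X : ModuleCat.{u} A} {i : ℕ} (e : Abelian.Ext X S.X₁ (i+1)) (h : pf e S.f = 0) :
    ∃ e', dv hS e' = e := Abelian.Ext.covariant_sequence_exact₁ X hS e h rfl
lemma pb_dv {X X' : ModuleCat.{u} A} {i : ℕ} (f : X ⟶ X') (e : Abelian.Ext X' S.X₃ i) :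
    pb f (dv hS e) = dv hS (pb f e) := by
  simp only [pb, dv]
  rw [Abelian.Ext.comp_assoc _ _ _ _ _ (by omega)]
lemma dv_smul {X : ModuleCat.{u} A} {i : ℕ} (r : A) (e : Abelian.Ext X S.X₃ i) :
    dv hS (r • e) = r • dv hS e := by simp [dv]
lemma dv_add {X : ModuleCat.{u} A} {i : ℕ} (e e' : Abelian.Ext X S.X₃ i) :
    dv hS (e + e') = dv hS e + dv hS e' := by simp [dv]
lemma dv_zero {X : ModuleCat.{u} A} {i : ℕ} :
    dv hS (0 : Abelian.Ext X S.X₃ i) = 0 := by simp [dv]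
lemma dc_zero {Y : ModuleCat.{u} A} {i : ℕ} :
    dc hS (0 : Abelian.Ext S.X₁ Y i) = 0 := by simp [dc]
lemma pf_dv {X : ModuleCat.{u} A} {i : ℕ} (e : Abelian.Ext X S.X₃ i) : pf (dv hS e) S.f = 0 := by
  simp only [pf, dv]
  rw [Abelian.Ext.comp_assoc _ _ _ _ (add_zero 1) (by omega), hS.extClass_comp, Abelian.Ext.comp_zero]
lemma dv_pf {X : ModuleCat.{u} A} {i : ℕ} (e : Abelian.Ext X S.X₂ i) : dv hS (pf e S.g) = 0 := by
  simp only [pf, dv]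
  rw [Abelian.Ext.comp_assoc _ _ _ _ (zero_add 1) (by omega), hS.comp_extClass, Abelian.Ext.comp_zero]
lemma dc_nat (φ : S ⟶ S') {Y : ModuleCat.{u} A} {i : ℕ} (e : Abelian.Ext S'.X₁ Y i) :
    pb φ.τ₃ (dc hS' e) = dc hS (pb φ.τ₁ e) := by
  simp only [pb, dc]
  rw [← Abelian.Ext.comp_assoc _ _ _ (add_zero 1) (by omega) (by omega),
    ShortComplex.ShortExact.extClass_naturality hS hS' φ,
    Abelian.Ext.comp_assoc _ _ _ _ _ (by omega)]
end LES
end P3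

section P4
variable {A : Type u} [CommRing A]

lemma exists_div_map {T : Type u} [AddCommGroup T] [Module A T] [IsNoetherian A T] (x : A) (t c : ℕ) :
    ∃ m, c + t ≤ m ∧ ∃ ψ : LinearMap.range (LinearMap.lsmul A T (x ^ m)) →ₗ[A] T,
      ∀ y, x ^ t • ψ y = y ∧ ψ y ∈ LinearMap.range (LinearMap.lsmul A T (x ^ c)) := by
  let f : ℕ →o Submodule A T :=
    ⟨fun n => LinearMap.ker (LinearMap.lsmul A T (x ^ n)), fun a b hab z hz => by
      simp only [LinearMap.mem_ker, LinearMap.lsmul_apply] at hz ⊢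
      rw [← Nat.sub_add_cancel hab, pow_add, mul_smul, hz, smul_zero]⟩
  obtain ⟨n0, hn0⟩ := monotone_stabilizes_iff_noetherian.2 (inferInstanceAs (IsNoetherian A T)) f
  refine ⟨max c n0 + t, by omega, ?_⟩
  let L := LinearMap.lsmul A T (x ^ (max c n0 + t))
  have hk : LinearMap.ker L ≤ LinearMap.ker (LinearMap.lsmul A T (x ^ (max c n0))) := by
    have h1 := hn0 (max c n0 + t) (by omega)
    have h2 := hn0 (max c n0) (by omega)
    exact le_of_eq (h1.symm.trans h2)
  refine ⟨(LinearMap.ker L).liftQ (LinearMap.lsmul A T (x ^ (max c n0))) hk ∘ₗ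
    (LinearMap.quotKerEquivRange L).symm.toLinearMap, ?_⟩
  rintro ⟨_, z, rfl⟩
  have : (LinearMap.quotKerEquivRange L).symm ⟨L z, z, rfl⟩ = Submodule.Quotient.mk z := by
    rw [LinearEquiv.symm_apply_eq]; rfl
  have h3 : ((LinearMap.ker L).liftQ (LinearMap.lsmul A T (x ^ (max c n0))) hk ∘ₗ
    (LinearMap.quotKerEquivRange L).symm.toLinearMap) ⟨L z, z, rfl⟩ = x ^ (max c n0) • z := by
    simp only [LinearMap.comp_apply, LinearEquiv.coe_coe]
    rw [this]; rfl
  refine ⟨?_, ?_⟩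
  · refine (congrArg (x ^ t • ·) h3).trans ?_
    simp only [smul_smul]
    rw [← pow_add, add_comm t]; rfl
  · refine ⟨x ^ (max c n0 - c) • z, ?_⟩
    refine Eq.trans ?_ h3.symm
    simp only [LinearMap.lsmul_apply, smul_smul]
    rw [← pow_add]; congr 2; omega

/-- `0 → y(A/I) → A/I → A/(I,y) → 0` -/
@[reducible] noncomputable def Sq (I : Ideal A) (y : A) : ShortComplex (ModuleCat.{u} A) :=
  ShortComplex.mk (X₁ := ModuleCat.of A (LinearMap.range (LinearMap.lsmul A (A ⧸ I) y)))
    (X₂ := ModuleCat.of A (A ⧸ I)) (X₃ := ModuleCat.of A (A ⧸ (I ⊔ Ideal.span {y})))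
    (ModuleCat.ofHom (Submodule.subtype _)) (qm le_sup_left) (by
      ext ⟨_, z, rfl⟩
      obtain ⟨z, rfl⟩ := Submodule.Quotient.mk_surjective _ z
      change (Submodule.Quotient.mk (y * z) : A ⧸ (I ⊔ Ideal.span {y})) = 0
      rw [Submodule.Quotient.mk_eq_zero]
      exact Ideal.mul_mem_right _ _ (Ideal.mem_sup_right (Ideal.mem_span_singleton_self y)))

lemma Sq_exact (I : Ideal A) (y : A) : (Sq I y).ShortExact where
  exact := by
    rw [ShortComplex.moduleCat_exact_iff]
    intro z hz
    obtain ⟨z, rfl⟩ := Submodule.Quotient.mk_surjective _ z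
    change (Submodule.Quotient.mk z : A ⧸ (I ⊔ Ideal.span {y})) = 0 at hz
    rw [Submodule.Quotient.mk_eq_zero, Submodule.mem_sup] at hz
    obtain ⟨i, hi, w, hw, rfl⟩ := hz
    obtain ⟨c, rfl⟩ := Ideal.mem_span_singleton'.1 hw
    refine ⟨⟨Submodule.Quotient.mk (i + c * y), Submodule.Quotient.mk c, ?_⟩, rfl⟩
    change (Submodule.Quotient.mk (y * c) : A ⧸ I) = _
    rw [Submodule.Quotient.eq]
    have : y * c - (i + c * y) = - i := by ring
    rw [this]; exact I.neg_mem hi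
  mono_f := (ModuleCat.mono_iff_injective _).2 Subtype.val_injective
  epi_g := (ModuleCat.epi_iff_surjective _).2 fun z => by
    obtain ⟨z, rfl⟩ := Submodule.Quotient.mk_surjective _ z
    exact ⟨Submodule.Quotient.mk z, rfl⟩

/-- map of short complexes -/
noncomputable def SqMap {I' I : Ideal A} {y' y : A} (h : I' ≤ I) (hy : y ∣ y') :
    Sq I' y' ⟶ Sq I y where
  τ₁ := ModuleCat.ofHom ((Submodule.mapQ I' I LinearMap.id h).restrict (by
    rintro _ ⟨z, rfl⟩
    obtain ⟨c, rfl⟩ := hy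
    refine ⟨c • Submodule.mapQ I' I LinearMap.id h z, ?_⟩
    simp only [LinearMap.lsmul_apply, map_smul, mul_smul]
    exact smul_comm _ _ _))
  τ₂ := qm h
  τ₃ := qm (sup_le_sup h (by rwa [Ideal.span_singleton_le_span_singleton]))
  comm₁₂ := rfl
  comm₂₃ := (qm_comp _ _).trans (qm_comp _ _).symm

lemma VV_step [IsNoetherianRing A] (J : ℕ → Ideal A) (hJ : Antitone J) (x : A) (i : ℕ)
    (N : ModuleCat.{u} A) (h1 : VV J (i+1) N)
    (h2 : VV J i N ∨ ∃ t, ∀ n : N, x ^ t • n = 0) :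
    VV (fun k => J k ⊔ Ideal.span {x ^ k}) (i+1) N := by
  intro k e
  obtain ⟨l, hkl, hJl, hl⟩ := h1 k (pb (qm le_sup_left) e)
  have hle : J l ⊔ Ideal.span {x ^ k} ≤ J k ⊔ Ideal.span {x ^ k} := sup_le_sup_right hJl _
  obtain ⟨f, hf⟩ := contra_ex3 (Sq_exact (J l) (x ^ k)) (pb (qm hle) e) (by
    change pb (qm le_sup_left) _ = 0
    change pb (qm hJl) (pb _ e) = 0 at hl
    rw [pb_pb, qm_comp] at hl ⊢
    exact hl)
  suffices H : ∃ l' m, l ≤ l' ∧ k ≤ m ∧ ∀ (h : J l' ≤ J l) (hm : x ^ k ∣ x ^ m),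
      pb (SqMap h hm).τ₁ f = 0 by
    obtain ⟨l', m, hl', hm, H⟩ := H
    have hf' := congrArg (pb (SqMap (hJ hl') (pow_dvd_pow x hm)).τ₃) hf
    rw [dc_nat (Sq_exact (J l') (x ^ m)), H, dc_zero] at hf'
    have hle2 : J (max l' m) ⊔ Ideal.span {x ^ (max l' m)} ≤ J l' ⊔ Ideal.span {x ^ m} :=
      sup_le_sup (hJ (le_max_left _ _)) (by
        rw [Ideal.span_singleton_le_span_singleton]; exact pow_dvd_pow _ (le_max_right _ _))
    refine ⟨max l' m, by omega, sup_le_sup (hJ (by omega)) (by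
        rw [Ideal.span_singleton_le_span_singleton]; exact pow_dvd_pow _ (by omega)), ?_⟩
    have h3 := congrArg (pb (qm hle2)) hf'
    change _ = pb (qm hle2) (pb (qm _) (pb (qm hle) e)) at h3
    rw [pb_zero, pb_pb, qm_comp, pb_pb, qm_comp] at h3
    exact h3.symm
  rcases h2 with h2 | ⟨t, ht⟩
  · let s : ModuleCat.of A (A ⧸ J l) ⟶ (Sq (J l) (x ^ k)).X₁ :=
      ModuleCat.ofHom (LinearMap.rangeRestrict (LinearMap.lsmul A (A ⧸ J l) (x ^ k)))
    obtain ⟨l', hl', hJl', hz⟩ := h2 l (pb s f)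
    obtain ⟨m, hm, ψ, hψ⟩ := exists_div_map (A := A) (T := A ⧸ J l') x k 0
    refine ⟨l', m, hl', by omega, fun h hd => ?_⟩
    have : (SqMap h hd).τ₁ = ModuleCat.ofHom ψ ≫ qm hJl' ≫ s := by
      ext y
      change Submodule.mapQ _ _ LinearMap.id h y.1 = x ^ k • Submodule.mapQ _ _ LinearMap.id h (ψ y)
      rw [← map_smul, (hψ y).1]
    rw [this, ← pb_pb, ← pb_pb]
    change pb _ ((Abelian.Ext.mk₀ (qm hJl')).comp _ _) = 0
    rw [hz, pb_zero]
  · obtain ⟨m, hm, ψ, hψ⟩ := exists_div_map (A := A) (T := A ⧸ J l) x t k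
    refine ⟨l, m, le_rfl, by omega, fun h hd => ?_⟩
    have : (SqMap h hd).τ₁ = x ^ t • ModuleCat.ofHom
        (ψ.codRestrict (LinearMap.range (LinearMap.lsmul A (A ⧸ J l) (x ^ k))) (fun y => (hψ y).2)) := by
      ext y
      change Submodule.mapQ _ _ LinearMap.id h y.1 = x ^ t • ψ y
      rw [(hψ y).1]
      obtain ⟨z, hz⟩ := Submodule.Quotient.mk_surjective _ y.1
      rw [← hz]; rfl
    rw [this, smul_pb]
    exact smul_eq_zero_right _ ht _
end P4

section P5
variable {A : Type u} [CommRing A]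

lemma VV_cofinal {J J' : ℕ → Ideal A} (hJ' : Antitone J') (h1 : ∀ n, ∃ m, J m ≤ J' n)
    (h2 : ∀ n, ∃ m, J' m ≤ J n) {i : ℕ} {N : ModuleCat.{u} A} (h : VV J i N) : VV J' i N := by
  intro n e
  obtain ⟨m, hm⟩ := h1 n
  obtain ⟨l, hl, hJl, hz⟩ := h m (pb (qm hm) e)
  obtain ⟨l', hl'⟩ := h2 l
  have hle : J' (max l' n) ≤ J l := (hJ' (le_max_left _ _)).trans hl'
  refine ⟨max l' n, le_max_right _ _, hJ' (le_max_right _ _), ?_⟩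
  have h3 := congrArg (pb (qm hle)) hz
  change pb _ (pb _ (pb _ e)) = _ at h3
  rw [pb_zero, pb_pb, qm_comp, pb_pb, qm_comp] at h3
  exact h3

/-- the system generated by powers -/
def JJ (s : List A) (k : ℕ) : Ideal A := match s with
  | [] => ⊥
  | x :: s => JJ s k ⊔ Ideal.span {x ^ k}

lemma JJ_anti (s : List A) : Antitone (JJ s) := by
  induction s with
  | nil => intro a b h; exact le_rfl
  | cons x s ih =>
    intro a b h
    refine sup_le_sup (ih h) ?_
    rw [Ideal.span_singleton_le_span_singleton]; exact pow_dvd_pow _ h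

lemma VV_bot (i : ℕ) (N : ModuleCat.{u} A) : VV (fun _ => (⊥ : Ideal A)) (i+1) N := by
  intro n e
  refine ⟨n, le_rfl, le_rfl, ?_⟩
  have : Projective (ModuleCat.of A (A ⧸ (⊥ : Ideal A))) := by
    have : Module.Projective A (A ⧸ (⊥ : Ideal A)) :=
      Module.Projective.of_equiv (Submodule.quotEquivOfEqBot ⊥ rfl).symm
    exact (IsProjective.iff_projective (R := A) (A ⧸ (⊥ : Ideal A))).1 this
  rw [Abelian.Ext.eq_zero_of_projective e, Abelian.Ext.comp_zero]

lemma JJ_bound [IsNoetherianRing A] (s : List A) (i : ℕ) (hi : s.length < i) (N : ModuleCat.{u} A) :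
    VV (JJ s) i N := by
  induction s generalizing i with
  | nil => obtain ⟨i, rfl⟩ := Nat.exists_eq_succ_of_ne_zero (by simp at hi; omega : i ≠ 0)
           exact VV_bot i N
  | cons x s ih =>
    simp at hi
    obtain ⟨i, rfl⟩ := Nat.exists_eq_succ_of_ne_zero (by omega : i ≠ 0)
    exact VV_step (JJ s) (JJ_anti s) x i N (ih _ (by omega)) (Or.inl (ih _ (by omega)))

lemma JJ_tors [IsNoetherianRing A] (s : List A) (i : ℕ) (N : ModuleCat.{u} A)
    (h : ∀ x ∈ s, ∃ t, ∀ n : N, x ^ t • n = 0) :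
    VV (JJ s) (i+1) N := by
  induction s with
  | nil => exact VV_bot i N
  | cons x s ih =>
    exact VV_step (JJ s) (JJ_anti s) x i N (ih fun y hy => h y (by simp [hy]))
      (Or.inr (h x (by simp)))

lemma JJ_to [IsNoetherianRing A] (s : List A) {i : ℕ} {N : ModuleCat.{u} A} (h : VV (JJ s) i N)
    (a : Ideal A) (ha : a = Ideal.span {x | x ∈ s}) : VV (fun n => a ^ n) i N := by
  refine VV_cofinal (fun x y h => Ideal.pow_le_pow_right h) ?_ ?_ h
  · intro n
    refine ⟨n, ?_⟩
    have : ∀ x ∈ s, x ∈ a := fun x hx => ha ▸ Ideal.subset_span hx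
    clear ha h
    induction s with
    | nil => exact bot_le
    | cons x s ih =>
      refine sup_le (ih fun y hy => this y (by simp [hy])) ?_
      rw [Ideal.span_singleton_le_iff_mem]
      exact Ideal.pow_mem_pow (this x (by simp)) n
  · intro n
    refine Ideal.exists_pow_le_of_le_radical_of_fg ?_ (IsNoetherian.noetherian a)
    rw [ha, Ideal.span_le]
    intro x hx
    refine ⟨n, ?_⟩
    clear ha h
    induction s with
    | nil => simp at hx
    | cons y s ih =>
      simp only [List.mem_cons, Set.mem_ofPred_eq] at hx
      rcases hx with rfl | hx
      · exact Ideal.mem_sup_right (Ideal.mem_span_singleton_self _)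
      · exact Ideal.mem_sup_left (ih hx)

lemma exists_list [IsNoetherianRing A] (a : Ideal A) : ∃ s : List A, a = Ideal.span {x | x ∈ s} := by
  obtain ⟨s, hs⟩ := IsNoetherian.noetherian a
  exact ⟨s.toList, by rw [← hs]; simp⟩

lemma VV_bound [IsNoetherianRing A] (a : Ideal A) :
    ∃ r, ∀ i, r < i → ∀ N : ModuleCat.{u} A, VV (fun n => a ^ n) i N := by
  obtain ⟨s, hs⟩ := exists_list a
  exact ⟨s.length, fun i hi N => JJ_to s (JJ_bound s i hi N) a hs⟩

lemma VV_tors [IsNoetherianRing A] (a : Ideal A) (i : ℕ) (N : ModuleCat.{u} A) (k : ℕ)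
    (h : ∀ x ∈ a ^ k, ∀ n : N, x • n = 0) : VV (fun n => a ^ n) (i+1) N := by
  obtain ⟨s, hs⟩ := exists_list a
  refine JJ_to s (JJ_tors s i N fun x hx => ⟨k, h _ (Ideal.pow_mem_pow ?_ k)⟩) a hs
  rw [hs]; exact Ideal.subset_span hx

/-- vanishing of local cohomology -/
def W (a : Ideal A) (i : ℕ) (N : ModuleCat.{u} A) : Prop := VV (fun n => a ^ n) i N

/-- local form: dies along -/
noncomputable def tr (a : Ideal A) {n l : ℕ} (h : n ≤ l) {N : ModuleCat.{u} A} {i : ℕ}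
    (e : Abelian.Ext (ModuleCat.of A (A ⧸ a ^ n)) N i) :
    Abelian.Ext (ModuleCat.of A (A ⧸ a ^ l)) N i := pb (qm (Ideal.pow_le_pow_right h)) e

variable {a : Ideal A} {n l m i : ℕ} {N N' : ModuleCat.{u} A}
lemma W_iff : W a i N ↔ ∀ n (e : Abelian.Ext (ModuleCat.of A (A ⧸ a ^ n)) N i),
    ∃ l, ∃ h : n ≤ l, tr a h e = 0 := by
  constructor
  · intro H n e
    obtain ⟨l, h, _, hz⟩ := H n e
    exact ⟨l, h, hz⟩
  · intro H n e
    obtain ⟨l, h, hz⟩ := H n e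
    exact ⟨l, h, Ideal.pow_le_pow_right h, hz⟩

lemma tr_tr (h : n ≤ l) (h' : l ≤ m) (e : Abelian.Ext (ModuleCat.of A (A ⧸ a ^ n)) N i) :
    tr a h' (tr a h e) = tr a (h.trans h') e := by
  rw [tr, tr, pb_pb, qm_comp]; rfl
lemma tr_self (e : Abelian.Ext (ModuleCat.of A (A ⧸ a ^ n)) N i) : tr a le_rfl e = e := by
  have : qm (le_refl (a ^ n)) = 𝟙 _ := by
    ext; rfl
  rw [tr, this, pb_id]
lemma tr_zero (h : n ≤ l) : tr a h (0 : Abelian.Ext _ N i) = 0 := pb_zero _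
lemma tr_add (h : n ≤ l) (e e' : Abelian.Ext _ N i) : tr a h (e + e') = tr a h e + tr a h e' := pb_add _ _ _
lemma tr_sub (h : n ≤ l) (e e' : Abelian.Ext _ N i) : tr a h (e - e') = tr a h e - tr a h e' := pb_sub _ _ _
lemma tr_smul (h : n ≤ l) (r : A) (e : Abelian.Ext _ N i) : tr a h (r • e) = r • tr a h e := pb_smul _ _ _
lemma tr_pf (h : n ≤ l) (g : N ⟶ N') (e : Abelian.Ext _ N i) : tr a h (pf e g) = pf (tr a h e) g :=
  pb_pf _ _ _
lemma tr_dv (h : n ≤ l) {S : ShortComplex (ModuleCat.{u} A)} (hS : S.ShortExact)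
    (e : Abelian.Ext _ S.X₃ i) : tr a h (dv hS e) = dv hS (tr a h e) :=
  pb_dv _ _ _

lemma W_mid {S : ShortComplex (ModuleCat.{u} A)} (hS : S.ShortExact) (h1 : W a i S.X₁) (h3 : W a i S.X₃) :
    W a i S.X₂ := by
  rw [W_iff] at *
  intro n e
  obtain ⟨l, hl, hz⟩ := h3 n (pf e S.g)
  rw [tr_pf] at hz
  obtain ⟨f, hf⟩ := cov_ex2 hS _ hz
  obtain ⟨m, hm, hz'⟩ := h1 l f
  refine ⟨m, hl.trans hm, ?_⟩
  rw [← tr_tr hl hm, ← hf, tr_pf, hz', pf_zero]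
lemma W_right {S : ShortComplex (ModuleCat.{u} A)} (hS : S.ShortExact) (h1 : W a (i+1) S.X₁) (h2 : W a i S.X₂) :
    W a i S.X₃ := by
  rw [W_iff] at *
  intro n e
  obtain ⟨l, hl, hz⟩ := h1 n (dv hS e)
  rw [tr_dv] at hz
  obtain ⟨f, hf⟩ := cov_ex3 hS _ hz
  obtain ⟨m, hm, hz'⟩ := h2 l f
  refine ⟨m, hl.trans hm, ?_⟩
  rw [← tr_tr hl hm, ← hf, tr_pf, hz', pf_zero]
lemma W_left {S : ShortComplex (ModuleCat.{u} A)} (hS : S.ShortExact) (h1 : W a (i+1) S.X₂) (h2 : W a i S.X₃) :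
    W a (i+1) S.X₁ := by
  rw [W_iff] at *
  intro n e
  obtain ⟨l, hl, hz⟩ := h1 n (pf e S.f)
  rw [tr_pf] at hz
  obtain ⟨f, hf⟩ := cov_ex1 hS _ hz
  obtain ⟨m, hm, hz'⟩ := h2 l f
  refine ⟨m, hl.trans hm, ?_⟩
  rw [← tr_tr hl hm, ← hf, tr_dv, hz', dv_zero]
lemma W_iso (f : N ≅ N') (h : W a i N) : W a i N' := by
  rw [W_iff] at *
  intro n e
  obtain ⟨l, hl, hz⟩ := h n (pf e f.inv)
  refine ⟨l, hl, ?_⟩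
  have := congrArg (fun z => pf z f.hom) hz
  simp only [tr_pf, pf_pf, Iso.inv_hom_id, pf_id] at this
  rw [this, pf_zero]
end P5

section P6
variable {A : Type u} [CommRing A]

/-- short complex from linear maps -/
@[reducible] noncomputable def SE {N₁ N₂ N₃ : Type u} [AddCommGroup N₁] [Module A N₁] [AddCommGroup N₂] [Module A N₂]
    [AddCommGroup N₃] [Module A N₃] (f : N₁ →ₗ[A] N₂) (g : N₂ →ₗ[A] N₃) (h : Function.Exact f g) :
    ShortComplex (ModuleCat.{u} A) :=
  ShortComplex.mk (ModuleCat.ofHom f) (ModuleCat.ofHom g) (by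
    ext x; exact h.apply_apply_eq_zero x)

lemma SE_exact {N₁ N₂ N₃ : Type u} [AddCommGroup N₁] [Module A N₁] [AddCommGroup N₂] [Module A N₂]
    [AddCommGroup N₃] [Module A N₃] {f : N₁ →ₗ[A] N₂} {g : N₂ →ₗ[A] N₃} (h : Function.Exact f g)
    (hf : Function.Injective f) (hg : Function.Surjective g) : (SE f g h).ShortExact where
  exact := by
    rw [ShortComplex.moduleCat_exact_iff]
    intro x hx
    exact (h x).1 hx
  mono_f := (ModuleCat.mono_iff_injective _).2 hf
  epi_g := (ModuleCat.epi_iff_surjective _).2 hg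

lemma W_subsingleton (a : Ideal A) (i : ℕ) (N : Type u) [AddCommGroup N] [Module A N] [Subsingleton N] :
    W a i (ModuleCat.of A N) := by
  rw [W_iff]
  intro n e
  refine ⟨n, le_rfl, ?_⟩
  rw [tr_self, ← one_smul A e]
  exact smul_eq_zero_right 1 (fun x => Subsingleton.elim (α := N) _ _) e

lemma ker_exact {N T : Type u} [AddCommGroup N] [Module A N] [AddCommGroup T] [Module A T] (φ : N →ₗ[A] T) :
    Function.Exact (LinearMap.ker φ).subtype φ.rangeRestrict := by
  intro x; simp [Subtype.ext_iff]

lemma mkQ_exact {T : Type u} [AddCommGroup T] [Module A T] (P : Submodule A T) :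
    Function.Exact P.subtype P.mkQ := by
  intro x; simp

theorem gruson [IsNoetherianRing A] (a : Ideal A) (i : ℕ) (N : Type u) [AddCommGroup N] [Module A N]
    [Module.Finite A N] (hN : W a i (ModuleCat.of A N))
    (hup : ∀ (L : Type u) [AddCommGroup L] [Module A L] [Module.Finite A L],
      Module.annihilator A N ≤ Module.annihilator A L → W a (i+1) (ModuleCat.of A L)) :
    ∀ (L : Type u) [AddCommGroup L] [Module A L] [Module.Finite A L],
      Module.annihilator A N ≤ Module.annihilator A L → W a i (ModuleCat.of A L) := by
  suffices H : ∀ J : Ideal A, Module.annihilator A N ≤ J →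
      ∀ (L : Type u) [AddCommGroup L] [Module A L] [Module.Finite A L],
      J ≤ Module.annihilator A L → W a i (ModuleCat.of A L) from H _ le_rfl
  intro J
  induction J using WellFoundedGT.induction with
  | ind J IH =>
  intro hJ L _ _ hfin
  induction hfin using IsNoetherianRing.induction_on_isQuotientEquivQuotientPrime A with
  | subsingleton T => intro _; exact W_subsingleton a i T
  | exact N₁ N₂ N₃ f g hf hg hfg h₁ h₃ =>
    intro hann
    exact W_mid (SE_exact hfg hf hg) (h₁ (hann.trans (f.annihilator_le_of_injective hf)))
      (h₃ (hann.trans (g.annihilator_le_of_surjective hg)))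
  | quotient T q e =>
    intro hann
    have hTq : Module.annihilator A T = q.1 := by
      rw [e.annihilator_eq, Ideal.annihilator_quotient]
    rcases hann.lt_or_eq with hlt | heq
    · exact IH _ hlt (hJ.trans hann) T le_rfl
    · have hq := q.2
      have hne : ∃ φ : N →ₗ[A] T, φ ≠ 0 := by
        by_contra hcon
        push Not at hcon
        have : Subsingleton (N →ₗ[A] T) := ⟨fun x y => (hcon x).trans (hcon y).symm⟩
        obtain ⟨r, hr, hreg⟩ := IsSMulRegular.subsingleton_linearMap_iff.1 this
        have hrT := (hJ.trans hann) hr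
        have : e.symm 1 = 0 := hreg (by simpa using Module.mem_annihilator.1 hrT _)
        have : (1 : A ⧸ q.1) = 0 := by simpa using congrArg e this
        exact one_ne_zero this
      obtain ⟨φ, hφ⟩ := hne
      have hr : W a i (ModuleCat.of A (LinearMap.range φ)) :=
        W_right (SE_exact (ker_exact φ) Subtype.val_injective φ.surjective_rangeRestrict)
          (hup _ (LinearMap.annihilator_le_of_injective _ (Submodule.subtype_injective (LinearMap.ker φ)))) hN
      obtain ⟨n, hn⟩ : ∃ n, φ n ≠ 0 := by
        by_contra hcon; push Not at hcon; exact hφ (LinearMap.ext hcon)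
      obtain ⟨c, hc⟩ := Ideal.Quotient.mk_surjective (e (φ n))
      have hcq : c ∉ q.1 := fun h => hn (by
        rw [← Ideal.Quotient.eq_zero_iff_mem, hc] at h
        simpa using h)
      refine W_mid (SE_exact (mkQ_exact (LinearMap.range φ)) Subtype.val_injective
        (Submodule.mkQ_surjective _)) hr ?_
      refine IH (J ⊔ Ideal.span {c}) ?_ (hJ.trans le_sup_left) _ ?_
      · refine lt_of_le_of_ne le_sup_left fun h => hcq ?_
        rw [← hTq, ← heq, h]
        exact Ideal.mem_sup_right (Ideal.mem_span_singleton_self c)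
      · refine sup_le (hann.trans (LinearMap.annihilator_le_of_surjective _ (Submodule.mkQ_surjective _))) ?_
        rw [Ideal.span_singleton_le_iff_mem, Module.mem_annihilator]
        intro t
        obtain ⟨t, rfl⟩ := Submodule.mkQ_surjective _ t
        rw [← map_smul, Submodule.mkQ_apply, Submodule.Quotient.mk_eq_zero]
        obtain ⟨t', ht'⟩ := Ideal.Quotient.mk_surjective (e t)
        refine ⟨t' • n, e.injective ?_⟩
        rw [map_smul, map_smul, map_smul, ← ht', ← hc]
        change Ideal.Quotient.mk _ (t' * c) = Ideal.Quotient.mk _ (c * t')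
        rw [mul_comm]

theorem gruson' [IsNoetherianRing A] (a : Ideal A) (g : ℕ) (N : Type u) [AddCommGroup N] [Module A N]
    [Module.Finite A N] (hN : ∀ i, g < i → W a i (ModuleCat.of A N)) (i : ℕ) (hi : g < i)
    (L : Type u) [AddCommGroup L] [Module A L] [Module.Finite A L]
    (hL : Module.annihilator A N ≤ Module.annihilator A L) : W a i (ModuleCat.of A L) := by
  obtain ⟨r, hr⟩ := VV_bound a
  suffices H : ∀ k i, g < i → r < i + k →  ∀ (L : Type u) [AddCommGroup L] [Module A L] [Module.Finite A L],
      Module.annihilator A N ≤ Module.annihilator A L → W a i (ModuleCat.of A L) from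
    H (r + 1) i hi (by omega) L hL
  intro k
  induction k with
  | zero => intro i _ h L _ _ _ _; exact hr i h _
  | succ k ih =>
    intro i hi h
    exact gruson a i N (hN i hi) (ih (i+1) (by omega) (by omega))
end P6

section P7
variable {R : Type u} [CommRing R] [IsNoetherianRing R] (S : Submonoid R)

lemma loc_lift0 (T Y : ModuleCat.{u} R) [Module.Finite R T]
    (φ : T.localizedModule S ⟶ Y.localizedModule S) :
    ∃ s : S, ∃ f : T ⟶ Y,
      algebraMap R (Localization S) s • φ = ModuleCat.localizedModuleMap S f := by
  have : Module.FinitePresentation R T := Module.finitePresentation_of_finite R T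
  obtain ⟨f, s, hf⟩ := Module.FinitePresentation.exists_lift_of_isLocalizedModule S
    (Y.localizedModuleMkLinearMap S) ((φ.hom.restrictScalars R) ∘ₗ (T.localizedModuleMkLinearMap S))
  refine ⟨s, ModuleCat.ofHom f, ?_⟩
  apply ModuleCat.hom_ext
  apply LinearMap.restrictScalars_injective R
  apply IsLocalizedModule.linearMap_ext S (T.localizedModuleMkLinearMap S) (Y.localizedModuleMkLinearMap S)
  ext t
  have h1 := LinearMap.congr_fun hf t
  have h2 := IsLocalizedModule.map_apply S (T.localizedModuleMkLinearMap S) (Y.localizedModuleMkLinearMap S) f t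
  refine Eq.trans ?_ (h1.symm.trans h2.symm)
  exact algebraMap_smul (Localization S) (s : R) (φ.hom (T.localizedModuleMkLinearMap S t))

lemma loc_proj (T : ModuleCat.{u} R) (h : Module.Projective R T) :
    Projective ((ModuleCat.localizedModuleFunctor S).obj T) := by
  have h1 : Module.Projective (Localization S) (T.localizedModule S) :=
        Module.projective_of_isLocalizedModule S (T.localizedModuleMkLinearMap S)
  exact (IsProjective.iff_projective (R := Localization S) (T.localizedModule S)).1 h1

lemma loc_lift (i : ℕ) : ∀ (T Y : ModuleCat.{u} R) [Module.Finite R T]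
    (e : Abelian.Ext ((ModuleCat.localizedModuleFunctor S).obj T) ((ModuleCat.localizedModuleFunctor S).obj Y) i),
    ∃ s : S, ∃ f : Abelian.Ext T Y i,
      algebraMap R (Localization S) s • e = f.mapExactFunctor (ModuleCat.localizedModuleFunctor S) := by
  induction i with
  | zero =>
    intro T Y _ e
    obtain ⟨φ, rfl⟩ := (Abelian.Ext.mk₀_bijective _ _).2 e
    obtain ⟨s, f, h⟩ := loc_lift0 S T Y φ
    refine ⟨s, Abelian.Ext.mk₀ f, ?_⟩
    rw [Abelian.Ext.mapExactFunctor_mk₀, ← Abelian.Ext.mk₀_smul]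
    exact congrArg Abelian.Ext.mk₀ h
  | succ i ih =>
    intro T Y _ e
    obtain ⟨n, π, hπ⟩ := Module.Finite.exists_fin' R T
    have hS := SE_exact (N₁ := LinearMap.ker π) (N₂ := Fin n → R) (N₃ := T) (f := (LinearMap.ker π).subtype) (g := π)
      (LinearMap.exact_subtype_ker_map π) Subtype.val_injective hπ
    have hS' := hS.map_of_exact (ModuleCat.localizedModuleFunctor S)
    have hproj : Projective ((ModuleCat.localizedModuleFunctor S).obj (ModuleCat.of R (Fin n → R))) :=
      loc_proj S (ModuleCat.of R (Fin n → R)) (inferInstanceAs (Module.Projective R (Fin n → R)))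
    obtain ⟨e', he'⟩ := contra_ex3 hS' e
      (@Abelian.Ext.eq_zero_of_projective _ _ _ _ _ _ _ hproj _)
    obtain ⟨s, f, hf⟩ := ih (ModuleCat.of R (LinearMap.ker π)) Y e'
    refine ⟨s, dc hS f, ?_⟩
    rw [dc, Abelian.Ext.mapExactFunctor_comp, Abelian.Ext.mapExactFunctor_extClass, ← hf, ← he', dc]
    exact (Abelian.Ext.comp_smul _ _ _ _).symm
end P7

section P8
variable {R : Type u} [CommRing R] (S : Submonoid R)

lemma qα (T : ModuleCat.{u} R) (t : T) (I : Ideal R) (hI : ∀ x ∈ I, x • t = 0)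
    (K : Ideal (Localization S)) (h : K ≤ I.map (algebraMap R (Localization S))) :
    ∃ α : ModuleCat.of (Localization S) (Localization S ⧸ K) ⟶ T.localizedModule S,
      α.hom (Submodule.Quotient.mk 1) = T.localizedModuleMkLinearMap S t := by
  let f : (Localization S) →ₗ[Localization S] T.localizedModule S :=
    LinearMap.toSpanSingleton (Localization S) (T.localizedModule S) (T.localizedModuleMkLinearMap S t)
  have hf : K ≤ LinearMap.ker f := by
    refine h.trans ?_
    rw [Ideal.map_le_iff_le_comap]
    intro x hx
    rw [Ideal.mem_comap, LinearMap.mem_ker, LinearMap.toSpanSingleton_apply, algebraMap_smul, ← map_smul,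
      hI x hx, map_zero]
  refine ⟨ModuleCat.ofHom (Submodule.liftQ K f hf), ?_⟩
  change Submodule.liftQ K f hf (Submodule.Quotient.mk 1) = _
  rw [Submodule.liftQ_apply, LinearMap.toSpanSingleton_apply, one_smul]

lemma qβ (T : ModuleCat.{u} R) (K : Ideal (Localization S)) (f0 : T →ₗ[R] Localization S ⧸ K) :
    ∃ β : T.localizedModule S ⟶ ModuleCat.of (Localization S) (Localization S ⧸ K),
      ∀ t, β.hom (T.localizedModuleMkLinearMap S t) = f0 t := by
  have hun : ∀ s : S, IsUnit (algebraMap R (Module.End R (Localization S ⧸ K)) s) := by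
    intro s
    rw [Module.End.isUnit_iff]
    have hu := IsLocalization.map_units (Localization S) s
    constructor
    · intro x y hxy
      have h' : algebraMap R (Localization S) s • x = algebraMap R (Localization S) s • y := by
        rw [algebraMap_smul, algebraMap_smul]; exact hxy
      exact hu.smul_left_cancel.1 h'
    · intro y
      refine ⟨((hu.unit⁻¹ : (Localization S)ˣ) : Localization S) • y, ?_⟩
      rw [Module.algebraMap_end_apply, ← algebraMap_smul (Localization S), smul_smul, IsUnit.mul_val_inv, one_smul]
  let f1 := IsLocalizedModule.lift S (T.localizedModuleMkLinearMap S) f0 hun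
  let f2 : T.localizedModule S →ₗ[Localization S] Localization S ⧸ K :=
    LinearMap.extendScalarsOfIsLocalization S (Localization S) f1
  refine ⟨ModuleCat.ofHom f2, fun t => ?_⟩
  exact IsLocalizedModule.lift_apply S (T.localizedModuleMkLinearMap S) f0 hun t

lemma locMap_apply {T Y : ModuleCat.{u} R} (f : T ⟶ Y) (t : T) :
    (ModuleCat.localizedModuleMap S f).hom (T.localizedModuleMkLinearMap S t) =
      Y.localizedModuleMkLinearMap S (f.hom t) :=
  IsLocalizedModule.map_apply S (T.localizedModuleMkLinearMap S)
      (Y.localizedModuleMkLinearMap S) _ _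

lemma W_loc [IsNoetherianRing R] (a : Ideal R) (i : ℕ) (M : Type u) [AddCommGroup M] [Module R M]
    (h : W a i (ModuleCat.of R M)) :
    W (a.map (algebraMap R (Localization S))) i (ModuleCat.of (Localization S) (LocalizedModule S M)) := by
  have hiso : (ModuleCat.of R M).localizedModule S ≅ ModuleCat.of (Localization S) (LocalizedModule S M) :=
    (Shrink.linearEquiv (Localization S) (LocalizedModule S M)).toModuleIso
  refine W_iso hiso ?_
  rw [W_iff] at *
  intro n e
  obtain ⟨β, hβ⟩ := qβ S (ModuleCat.of R (R ⧸ a ^ n)) (a.map (algebraMap R (Localization S)) ^ n)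
    (Submodule.liftQ (a ^ n) (((a.map (algebraMap R (Localization S)) ^ n).mkQ.restrictScalars R) ∘ₗ
      (Algebra.linearMap R (Localization S))) (by
      intro x hx
      rw [LinearMap.mem_ker]
      change Submodule.Quotient.mk _ = _
      rw [Submodule.Quotient.mk_eq_zero, ← Ideal.map_pow]
      exact Ideal.mem_map_of_mem _ hx))
  replace hβ := hβ (Submodule.Quotient.mk 1)
  change _ = Submodule.Quotient.mk (algebraMap R (Localization S) 1) at hβ
  rw [map_one] at hβ
  obtain ⟨s, f, hf⟩ := loc_lift S i (ModuleCat.of R (R ⧸ a ^ n)) (ModuleCat.of R M) (pb β e)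
  obtain ⟨l, hl, hz⟩ := h n f
  refine ⟨l, hl, ?_⟩
  obtain ⟨α, hα⟩ := qα S (ModuleCat.of R (R ⧸ a ^ l)) (Submodule.Quotient.mk 1) (a ^ l) (fun x hx => by
    change (Submodule.Quotient.mk (x • 1) : R ⧸ a ^ l) = 0
    rw [Submodule.Quotient.mk_eq_zero]; simpa using hx) (a.map (algebraMap R (Localization S)) ^ l) (Ideal.map_pow _ _ _).ge
  have hc : α ≫ ModuleCat.localizedModuleMap S (qm (Ideal.pow_le_pow_right hl)) ≫ β =
      qm (Ideal.pow_le_pow_right hl) := by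
    apply ModuleCat.hom_ext
    apply Submodule.linearMap_qext
    apply LinearMap.ext_ring
    change β.hom ((ModuleCat.localizedModuleMap S (qm (Ideal.pow_le_pow_right hl))).hom (α.hom (Submodule.Quotient.mk 1))) = 
      Submodule.Quotient.mk 1
    rw [hα]
    refine Eq.trans (congrArg β.hom ?_) hβ
    exact locMap_apply S _ _
  have h1 : pb (ModuleCat.localizedModuleMap S (qm (Ideal.pow_le_pow_right hl)))
      (algebraMap R (Localization S) s • pb β e) = 0 := by
    have := congrArg (Abelian.Ext.mapExactFunctor (ModuleCat.localizedModuleFunctor S)) hz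
    rw [tr, pb, Abelian.Ext.mapExactFunctor_comp, Abelian.Ext.mapExactFunctor_mk₀,
      Abelian.Ext.mapExactFunctor_zero, ← hf] at this
    exact this
  have h2 := congrArg (pb α) h1
  rw [pb_smul, pb_smul, pb_zero, pb_pb, pb_pb, Category.assoc, hc] at h2
  exact (IsLocalization.map_units (Localization S) s).smul_eq_zero.1 h2
end P8

section P9
variable {A : Type u} [CommRing A] {H : Type u} [AddCommGroup H] [Module A H]

/-- secondary submodule -/
def IsSec (N : Submodule A H) : Prop :=
  N ≠ ⊥ ∧ ∀ x : A, (∀ y ∈ N, ∃ z ∈ N, x • z = y) ∨ ∃ n, ∀ y ∈ N, x ^ n • y = 0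

lemma exists_sec [IsArtinian A H] (N : Submodule A H) :
    ∃ s : Finset (Submodule A H), (∀ P ∈ s, IsSec P) ∧ s.sup id = N := by
  classical
  induction N using WellFoundedLT.induction with
  | ind N ih =>
  by_cases h0 : N = ⊥
  · exact ⟨∅, by simp, by simp [h0]⟩
  by_cases h1 : ∃ N1 N2 : Submodule A H, N1 < N ∧ N2 < N ∧ N1 ⊔ N2 = N
  · obtain ⟨N1, N2, l1, l2, h⟩ := h1
    obtain ⟨s1, hs1, e1⟩ := ih N1 l1
    obtain ⟨s2, hs2, e2⟩ := ih N2 l2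
    refine ⟨s1 ∪ s2, fun P hP => ?_, by rw [Finset.sup_union, e1, e2, h]⟩
    rcases Finset.mem_union.1 hP with h | h
    · exact hs1 P h
    · exact hs2 P h
  push Not at h1
  refine ⟨{N}, ?_, by simp⟩
  simp only [Finset.mem_singleton, forall_eq]
  refine ⟨h0, fun x => ?_⟩
  let f : ℕ →o (Submodule A H)ᵒᵈ := ⟨fun n => OrderDual.toDual (N.map (LinearMap.lsmul A H (x ^ n))), by
    intro a b hab
    rw [OrderDual.toDual_le_toDual]
    rintro _ ⟨y, hy, rfl⟩
    refine ⟨x ^ (b - a) • y, N.smul_mem _ hy, ?_⟩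
    simp only [LinearMap.lsmul_apply, smul_smul]
    rw [← pow_add]; congr 2; omega⟩
  obtain ⟨n, hn⟩ := IsArtinian.monotone_stabilizes f
  have hn2 : N.map (LinearMap.lsmul A H (x ^ n)) = N.map (LinearMap.lsmul A H (x ^ (n + n))) := hn (n+n) (by omega)
  have hn1 : N.map (LinearMap.lsmul A H (x ^ n)) = N.map (LinearMap.lsmul A H (x ^ (n + 1))) := hn (n+1) (by omega)
  have le1 : N.map (LinearMap.lsmul A H (x ^ n)) ≤ N := by
    rintro _ ⟨y, hy, rfl⟩; exact N.smul_mem _ hy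
  let K := N ⊓ LinearMap.ker (LinearMap.lsmul A H (x ^ n))
  have hsum : N.map (LinearMap.lsmul A H (x ^ n)) ⊔ K = N := by
    refine le_antisymm (sup_le le1 inf_le_left) fun y hy => ?_
    have : x ^ n • y ∈ N.map (LinearMap.lsmul A H (x ^ (n + n))) := hn2 ▸ ⟨y, hy, rfl⟩
    obtain ⟨z, hz, hzy⟩ := this
    refine Submodule.mem_sup.2 ⟨x ^ n • z, ⟨z, hz, rfl⟩, y - x ^ n • z, ⟨N.sub_mem hy (N.smul_mem _ hz), ?_⟩, by abel⟩
    rw [LinearMap.lsmul_apply] at hzy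
    rw [SetLike.mem_coe, LinearMap.mem_ker, LinearMap.lsmul_apply, smul_sub, smul_smul, ← pow_add, hzy, sub_self]
  rcases le1.lt_or_eq with hlt | heq
  · right
    have : K = N := by
      by_contra hK
      exact h1 _ K hlt (lt_of_le_of_ne inf_le_left hK) hsum
    exact ⟨n, fun y hy => (this.symm ▸ hy : y ∈ K).2⟩
  · left
    intro y hy
    rw [← heq, hn1] at hy
    obtain ⟨z, hz, rfl⟩ := hy
    exact ⟨x ^ n • z, N.smul_mem _ hz, by rw [LinearMap.lsmul_apply, smul_smul, ← pow_succ']⟩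

lemma IsSec.prime {N : Submodule A H} (h : IsSec N) : N.annihilator.radical.IsPrime := by
  have key : ∀ x, x ∈ N.annihilator.radical ↔ ∃ n, ∀ y ∈ N, x ^ n • y = 0 := by
    intro x
    simp only [Ideal.mem_radical_iff, Submodule.mem_annihilator]
  refine Ideal.isPrime_iff.2 ⟨fun ht => h.1 ?_, fun {x y} hxy => ?_⟩
  · rw [Ideal.eq_top_iff_one, key] at ht
    obtain ⟨n, hn⟩ := ht
    rw [eq_bot_iff]; intro y hy; simpa using hn y hy
  · by_contra hcon
    push Not at hcon
    rw [key, key] at hcon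
    rw [key] at hxy
    have hx := (h.2 x).resolve_right hcon.1
    obtain ⟨n, hn⟩ := hxy
    have hxn : ∀ m, ∀ y ∈ N, ∃ z ∈ N, x ^ m • z = y := by
      intro m
      induction m with
      | zero => intro y hy; exact ⟨y, hy, by simp⟩
      | succ m ih =>
        intro y hy
        obtain ⟨z, hz, rfl⟩ := hx y hy
        obtain ⟨w, hw, rfl⟩ := ih z hz
        exact ⟨w, hw, by rw [smul_smul, pow_succ']⟩
    refine hcon.2 ⟨n, fun w hw => ?_⟩
    obtain ⟨z, hz, rfl⟩ := hxn n w hw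
    rw [smul_smul, ← mul_pow, mul_comm y x]; exact hn z hz

lemma exists_surj [IsNoetherianRing A] [IsArtinian A H] (b : Ideal A)
    (hb : b • (⊤ : Submodule A H) = ⊤) : ∃ x ∈ b, ∀ y : H, ∃ z, x • z = y := by
  classical
  obtain ⟨s, hs, hsup⟩ := exists_sec (⊤ : Submodule A H)
  let s' := s.filter fun N => ¬ b ≤ N.annihilator.radical
  have hpow : ∀ k, b ^ k • (⊤ : Submodule A H) = ⊤ := by
    intro k
    induction k with
    | zero => simp
    | succ k ih => rw [pow_succ, Submodule.mul_smul, hb, ih]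
  have hsup' : s'.sup id = ⊤ := by
    have h1 : ∀ N ∈ s, ∃ k, b ^ k • N ≤ s'.sup id := by
      intro N hN
      by_cases hbN : b ≤ N.annihilator.radical
      · obtain ⟨k, hk⟩ := Ideal.exists_pow_le_of_le_radical_of_fg hbN (IsNoetherian.noetherian b)
        refine ⟨k, ?_⟩
        rw [Submodule.smul_le]
        intro r hr n hn
        rw [Submodule.mem_annihilator.1 (hk hr) n hn]; exact zero_mem _
      · exact ⟨0, by simpa using Finset.le_sup (f := id) (Finset.mem_filter.2 ⟨hN, hbN⟩)⟩
    choose! k hk using h1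
    rw [eq_top_iff, ← hpow (s.sup k), ← hsup]
    have h2 : s.sup id ≤ (Submodule.comap (LinearMap.id) (s.sup id)) := le_rfl
    rw [Finset.sup_id_eq_sSup, sSup_eq_iSup', Submodule.smul_iSup]
    refine iSup_le fun N => ?_
    exact (Submodule.smul_mono_left (Ideal.pow_le_pow_right (Finset.le_sup N.2))).trans (hk N.1 N.2)
  have hex : ∃ x ∈ b, ∀ N ∈ s', x ∉ N.annihilator.radical := by
    by_contra hcon
    push Not at hcon
    have hsub : (b : Set A) ⊆ ⋃ N ∈ (s' : Set (Submodule A H)), (N.annihilator.radical : Set A) := by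
      intro x hx
      obtain ⟨N, hN, hxN⟩ := hcon x hx
      exact Set.mem_iUnion₂.2 ⟨N, hN, hxN⟩
    obtain ⟨N, hN, hbN⟩ := (Ideal.subset_union_prime (R := A) (f := fun N : Submodule A H => N.annihilator.radical) ⊥ ⊥
      (fun N hN _ _ => (hs N (Finset.mem_filter.1 hN).1).prime)).1 hsub
    exact (Finset.mem_filter.1 hN).2 hbN
  obtain ⟨x, hxb, hx⟩ := hex
  refine ⟨x, hxb, fun y => ?_⟩
  have : s'.sup id ≤ LinearMap.range (LinearMap.lsmul A H x) := by
    refine Finset.sup_le fun N hN y hy => ?_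
    rcases (hs N (Finset.mem_filter.1 hN).1).2 x with h | ⟨n, hn⟩
    · obtain ⟨z, _, hz⟩ := h y hy
      exact ⟨z, hz⟩
    · exact absurd ⟨n, Submodule.mem_annihilator.2 hn⟩ (hx N hN)
  obtain ⟨z, hz⟩ := (hsup' ▸ this) (Submodule.mem_top (x := y))
  exact ⟨z, hz⟩

/-- Melkersson -/
lemma melkersson (x : A) (ht : ∀ h : H, ∃ n, x ^ n • h = 0)
    [IsArtinian A (LinearMap.ker (LinearMap.lsmul A H x))] : IsArtinian A H := by
  let K := LinearMap.ker (LinearMap.lsmul A H x)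
  let T : Submodule A H → ℕ → Submodule A K := fun N n =>
    (N.map (LinearMap.lsmul A H (x ^ n))).comap K.subtype
  have hT : ∀ {N N' : Submodule A H} {n n' : ℕ}, N' ≤ N → n ≤ n' → T N' n' ≤ T N n := by
    rintro N N' n n' h h' k ⟨y, hy, hyk⟩
    refine ⟨x ^ (n' - n) • y, N.smul_mem _ (h hy), ?_⟩
    rw [← hyk]
    simp only [LinearMap.lsmul_apply, smul_smul]
    rw [← pow_add]; congr 2; omega
  rw [← monotone_stabilizes_iff_artinian]
  intro f
  have hf : ∀ {i j}, i ≤ j → OrderDual.ofDual (f j) ≤ OrderDual.ofDual (f i) := fun h => f.monotone h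
  let d : ℕ →o (Submodule A K)ᵒᵈ := ⟨fun i => OrderDual.toDual (T (OrderDual.ofDual (f i)) i),
    fun i j h => hT (hf h) h⟩
  obtain ⟨i0, hi0⟩ := IsArtinian.monotone_stabilizes d
  have hi0' : ∀ m, i0 ≤ m → T (OrderDual.ofDual (f i0)) i0 = T (OrderDual.ofDual (f m)) m := hi0
  have hn : ∀ n, ∃ k, ∀ m, k ≤ m → T (OrderDual.ofDual (f k)) n = T (OrderDual.ofDual (f m)) n := by
    intro n
    let d' : ℕ →o (Submodule A K)ᵒᵈ := ⟨fun i => OrderDual.toDual (T (OrderDual.ofDual (f i)) n),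
      fun i j h => hT (hf h) le_rfl⟩
    exact IsArtinian.monotone_stabilizes d'
  choose k hk using hn
  refine ⟨max i0 ((Finset.range i0).sup k), fun m hm => ?_⟩
  have hall : ∀ n, T (OrderDual.ofDual (f (max i0 ((Finset.range i0).sup k)))) n ≤ T (OrderDual.ofDual (f m)) n := by
    intro n
    rcases lt_or_ge n i0 with h | h
    · have h1 : k n ≤ max i0 ((Finset.range i0).sup k) :=
        (Finset.le_sup (Finset.mem_range.2 h)).trans (le_max_right _ _)
      rw [← hk n _ h1, ← hk n _ (h1.trans hm)]
    · calc _ ≤ T (OrderDual.ofDual (f i0)) i0 := hT (hf (le_max_left _ _)) h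
        _ = T (OrderDual.ofDual (f (max m n))) (max m n) := hi0' _ (by omega)
        _ ≤ _ := hT (hf (le_max_left _ _)) (le_max_right _ _)
  refine le_antisymm (f.monotone hm) ?_
  change OrderDual.ofDual (f (max i0 ((Finset.range i0).sup k))) ≤ OrderDual.ofDual (f m)
  have hle := hf hm
  revert hle hall
  generalize OrderDual.ofDual (f (max i0 ((Finset.range i0).sup k))) = N
  generalize OrderDual.ofDual (f m) = N'
  intro hall hle
  have key : ∀ n, ∀ y ∈ N, x ^ n • y = 0 → y ∈ N' := by
    intro n
    induction n with
    | zero => intro y _ h; simp at h; rw [h]; exact zero_mem _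
    | succ n ih =>
      intro y hy h
      have hmem : x ^ n • y ∈ K := by
        rw [LinearMap.mem_ker, LinearMap.lsmul_apply, smul_smul, ← pow_succ', h]
      obtain ⟨z, hz, hzy⟩ := hall n (show (⟨_, hmem⟩ : K) ∈ T N n from ⟨y, hy, rfl⟩)
      have hzy' : x ^ n • z = x ^ n • y := hzy
      have h3 := ih (y - z) (N.sub_mem hy (hle hz)) (by rw [smul_sub, hzy', sub_self])
      simpa using N'.add_mem h3 hz
  intro y hy
  obtain ⟨n, hn⟩ := ht y
  exact key n y hy hn
end P9

section P10
variable {A : Type u} [CommRing A]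

/-- transition -/
noncomputable def trL (b : Ideal A) (i : ℕ) (N : ModuleCat.{u} A) (n l : ℕ) (h : n ≤ l) :
    Abelian.Ext (ModuleCat.of A (A ⧸ b ^ n)) N i →ₗ[A]
      Abelian.Ext (ModuleCat.of A (A ⧸ b ^ l)) N i where
  toFun e := tr b h e
  map_add' := tr_add h
  map_smul' := tr_smul h

instance trL_dir (b : Ideal A) (i : ℕ) (N : ModuleCat.{u} A) :
    DirectedSystem (fun n => Abelian.Ext (ModuleCat.of A (A ⧸ b ^ n)) N i)
      (fun n l h => trL b i N n l h) where
  map_self := fun _ e => tr_self e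
  map_map := fun _ _ _ h h' e => tr_tr h h' e

/-- local cohomology as direct limit -/
def HH (b : Ideal A) (i : ℕ) (N : ModuleCat.{u} A) : Type u :=
  Module.DirectLimit (fun n => Abelian.Ext (ModuleCat.of A (A ⧸ b ^ n)) N i) (trL b i N)

noncomputable instance (b : Ideal A) (i : ℕ) (N : ModuleCat.{u} A) : AddCommGroup (HH b i N) :=
  inferInstanceAs (AddCommGroup (Module.DirectLimit _ (trL b i N)))
noncomputable instance (b : Ideal A) (i : ℕ) (N : ModuleCat.{u} A) : Module A (HH b i N) :=
  inferInstanceAs (Module A (Module.DirectLimit _ (trL b i N)))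

variable {b : Ideal A} {i : ℕ} {N N' : ModuleCat.{u} A}

/-- canonical map -/
noncomputable def hof (b : Ideal A) (i : ℕ) (N : ModuleCat.{u} A) (n : ℕ) :
    Abelian.Ext (ModuleCat.of A (A ⧸ b ^ n)) N i →ₗ[A] HH b i N :=
  Module.DirectLimit.of A ℕ _ (trL b i N) n

lemma hof_tr {n l : ℕ} (h : n ≤ l) (e : Abelian.Ext (ModuleCat.of A (A ⧸ b ^ n)) N i) :
    hof b i N l (tr b h e) = hof b i N n e :=
  Module.DirectLimit.of_f (f := trL b i N) (hij := h) (x := e)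

lemma hof_surj (z : HH b i N) : ∃ n e, hof b i N n e = z := Module.DirectLimit.exists_of z

lemma hof_zero {n : ℕ} {e : Abelian.Ext (ModuleCat.of A (A ⧸ b ^ n)) N i} (h : hof b i N n e = 0) :
    ∃ l, ∃ h : n ≤ l, tr b h e = 0 := Module.DirectLimit.of.zero_exact h

/-- lift -/
noncomputable def hlift {P : Type u} [AddCommGroup P] [Module A P]
    (g : ∀ n, Abelian.Ext (ModuleCat.of A (A ⧸ b ^ n)) N i →ₗ[A] P)
    (hg : ∀ n l (h : n ≤ l) e, g l (tr b h e) = g n e) : HH b i N →ₗ[A] P :=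
  Module.DirectLimit.lift A ℕ _ (trL b i N) g hg

lemma hlift_of {P : Type u} [AddCommGroup P] [Module A P]
    (g : ∀ n, Abelian.Ext (ModuleCat.of A (A ⧸ b ^ n)) N i →ₗ[A] P)
    (hg : ∀ n l (h : n ≤ l) e, g l (tr b h e) = g n e) (n : ℕ) (e) :
    hlift g hg (hof b i N n e) = g n e := Module.DirectLimit.lift_of _ _ _

/-- pushforward, linear -/
noncomputable def pfL (X : ModuleCat.{u} A) (i : ℕ) (g : N ⟶ N') :
    Abelian.Ext X N i →ₗ[A] Abelian.Ext X N' i where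
  toFun e := pf e g
  map_add' e e' := pf_add g e e'
  map_smul' r e := pf_smul g r e

/-- connecting, linear -/
noncomputable def dvL (X : ModuleCat.{u} A) (i : ℕ) {S : ShortComplex (ModuleCat.{u} A)}
    (hS : S.ShortExact) : Abelian.Ext X S.X₃ i →ₗ[A] Abelian.Ext X S.X₁ (i+1) where
  toFun e := dv hS e
  map_add' e e' := dv_add hS e e'
  map_smul' r e := dv_smul hS r e

/-- functoriality -/
noncomputable def hmap (b : Ideal A) (i : ℕ) (g : N ⟶ N') : HH b i N →ₗ[A] HH b i N' :=
  hlift (fun n => (hof b i N' n).comp (pfL (ModuleCat.of A (A ⧸ b ^ n)) i g))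
    (fun n l h e => by
      rw [LinearMap.comp_apply, LinearMap.comp_apply, ← hof_tr h]
      exact congrArg _ (tr_pf h g e).symm)

lemma hmap_of (g : N ⟶ N') (n : ℕ) (e) : hmap b i g (hof b i N n e) = hof b i N' n (pf e g) :=
  hlift_of _ _ _ _

/-- connecting -/
noncomputable def hdv (b : Ideal A) (i : ℕ) {S : ShortComplex (ModuleCat.{u} A)} (hS : S.ShortExact) :
    HH b i S.X₃ →ₗ[A] HH b (i+1) S.X₁ :=
  hlift (fun n => (hof b (i+1) S.X₁ n).comp (dvL (ModuleCat.of A (A ⧸ b ^ n)) i hS))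
    (fun n l h e => by
      rw [LinearMap.comp_apply, LinearMap.comp_apply, ← hof_tr h]
      exact congrArg _ (tr_dv h hS e).symm)

lemma hdv_of {S : ShortComplex (ModuleCat.{u} A)} (hS : S.ShortExact) (n : ℕ) (e) :
    hdv b i hS (hof b i S.X₃ n e) = hof b (i+1) S.X₁ n (dv hS e) :=
  hlift_of _ _ _ _

lemma hmap_inj {S : ShortComplex (ModuleCat.{u} A)} (hS : S.ShortExact) (h1 : W b i S.X₁) :
    Function.Injective (hmap b i S.g) := by
  rw [injective_iff_map_eq_zero]
  intro z hz
  obtain ⟨n, e, rfl⟩ := hof_surj z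
  rw [hmap_of] at hz
  obtain ⟨l, h, hl⟩ := hof_zero hz
  rw [tr_pf] at hl
  obtain ⟨e', he'⟩ := cov_ex2 hS _ hl
  obtain ⟨m, h', hm⟩ := W_iff.1 h1 l e'
  rw [← hof_tr h, ← hof_tr h', ← he', tr_pf, hm, pf_zero, map_zero]

lemma art_of_ses {S : ShortComplex (ModuleCat.{u} A)} (hS : S.ShortExact) (h1 : W b i S.X₁)
    (h : IsArtinian A (HH b i S.X₃)) : IsArtinian A (HH b i S.X₂) :=
  isArtinian_of_injective (hmap b i S.g) (hmap_inj hS h1)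

lemma hdv_ker {S : ShortComplex (ModuleCat.{u} A)} (hS : S.ShortExact) (z : HH b (i+1) S.X₁)
    (hz : hmap b (i+1) S.f z = 0) : z ∈ LinearMap.range (hdv b i hS) := by
  obtain ⟨n, e, rfl⟩ := hof_surj z
  rw [hmap_of] at hz
  obtain ⟨l, h, hl⟩ := hof_zero hz
  rw [tr_pf] at hl
  obtain ⟨e', he'⟩ := cov_ex1 hS _ hl
  exact ⟨hof _ _ _ l e', by rw [hdv_of, he', hof_tr]⟩

lemma hmap_smul (r : A) (z : HH b i N) : hmap b i (r • 𝟙 N) z = r • z := by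
  obtain ⟨n, e, rfl⟩ := hof_surj z
  rw [hmap_of, smul_pf, pf_id, map_smul]

lemma hh_tors (z : HH b i N) : ∃ n, ∀ x ∈ b ^ n, x • z = 0 := by
  obtain ⟨n, e, rfl⟩ := hof_surj z
  refine ⟨n, fun x hx => ?_⟩
  rw [← map_smul, smul_eq_zero_left, map_zero]
  intro y
  obtain ⟨y, rfl⟩ := Ideal.Quotient.mk_surjective y
  change x • (Ideal.Quotient.mk (b ^ n) y) = 0
  rw [Algebra.smul_def]
  change (Ideal.Quotient.mk (b ^ n) x) * _ = 0
  rw [Ideal.Quotient.eq_zero_iff_mem.2 hx, zero_mul]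

lemma hh_ann (r : A) (hr : ∀ y : N, r • y = 0) (z : HH b i N) : r • z = 0 := by
  obtain ⟨n, e, rfl⟩ := hof_surj z
  rw [← map_smul, smul_eq_zero_right r hr, map_zero]

lemma exists_gamma [IsNoetherianRing A] (b : Ideal A) (N : Type u) [AddCommGroup N] [Module A N]
    [Module.Finite A N] : ∃ G : Submodule A N, (∃ k, ∀ x ∈ b ^ k, ∀ y ∈ G, x • y = 0) ∧
      ∃ x ∈ b, IsSMulRegular (N ⧸ G) x := by
  let T : ℕ →o Submodule A N := ⟨fun k => Submodule.torsionBySet A N (b ^ k : Ideal A),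
    fun k l h => Submodule.torsionBySet_le_torsionBySet_of_subset (Ideal.pow_le_pow_right h)⟩
  obtain ⟨k, hk⟩ := monotone_stabilizes_iff_noetherian.2 (inferInstance : IsNoetherian A N) T
  refine ⟨T k, ⟨k, fun x hx y hy => ?_⟩, ?_⟩
  · exact (Submodule.mem_torsionBySet_iff _ _).1 hy ⟨x, hx⟩
  · have := (IsSMulRegular.subsingleton_linearMap_iff (R := A) (N := A ⧸ b) (M := N ⧸ T k)).1 ?_
    · simpa [Ideal.annihilator_quotient] using this
    · refine ⟨fun f g => ?_⟩
      suffices ∀ f : (A ⧸ b) →ₗ[A] (N ⧸ T k), f = 0 by rw [this f, this g]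
      intro f
      have h1 : f (Ideal.Quotient.mk b 1) = 0 := by
        obtain ⟨y, hy⟩ := Submodule.mkQ_surjective _ (f (Ideal.Quotient.mk b 1))
        rw [← hy]
        have : y ∈ T (k+1) := by
          refine (Submodule.mem_torsionBySet_iff _ _).2 ?_
          rintro ⟨x, hx⟩
          change x • y = 0
          rw [SetLike.mem_coe, pow_succ] at hx
          induction hx using Submodule.mul_induction_on' with
          | mem_mul_mem u hu v hv =>
            have hvy : v • y ∈ T k := by
              rw [← Submodule.ker_mkQ (T k), LinearMap.mem_ker, map_smul, hy, ← map_smul]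
              have : v • (Ideal.Quotient.mk b 1) = 0 := by
                rw [Algebra.smul_def]
                change (Ideal.Quotient.mk b v) * _ = 0
                rw [Ideal.Quotient.eq_zero_iff_mem.2 hv, zero_mul]
              rw [this, map_zero]
            rw [mul_smul]
            exact (Submodule.mem_torsionBySet_iff _ _).1 hvy ⟨u, hu⟩
          | add u _ v _ hu hv => rw [add_smul, hu, hv, add_zero]
        rw [← hk (k+1) (Nat.le_succ k)] at this
        rwa [← LinearMap.mem_ker, Submodule.ker_mkQ]
      ext
      simpa using h1

/-- Artinianness hypothesis -/
def ArtHyp (b I : Ideal A) : Prop := ∀ (L : Type u) [AddCommGroup L] [Module A L] [Module.Finite A L],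
  I ≤ Module.annihilator A L → (∃ k, b ^ k ≤ Module.annihilator A L) → IsArtinian A L

lemma hh_zero_art [IsNoetherianRing A] (b I : Ideal A) (hb : ArtHyp b I)
    (N : Type u) [AddCommGroup N] [Module A N] [Module.Finite A N] (hN : I ≤ Module.annihilator A N) :
    IsArtinian A (HH b 0 (ModuleCat.of A N)) := by
  let q : ∀ n, ModuleCat.of A A ⟶ ModuleCat.of A (A ⧸ b ^ n) := fun n => ModuleCat.ofHom (b ^ n).mkQ
  let F : HH b 0 (ModuleCat.of A N) →ₗ[A] Abelian.Ext (ModuleCat.of A A) (ModuleCat.of A N) 0 :=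
    hlift (fun n => { toFun := fun e => pb (q n) e, map_add' := pb_add _, map_smul' := pb_smul _ })
      (fun n l h e => by
        change pb (q l) (tr b h e) = pb (q n) e
        rw [tr, pb_pb]; rfl)
  have hF : Function.Injective F := by
    rw [injective_iff_map_eq_zero]
    intro z hz
    obtain ⟨n, e, rfl⟩ := hof_surj z
    have : pb (q n) e = 0 := (hlift_of _ _ _ _).symm.trans hz
    obtain ⟨f, rfl⟩ := (Abelian.Ext.mk₀_bijective _ _).2 e
    simp only [pb, Abelian.Ext.mk₀_comp_mk₀] at this
    rw [Abelian.Ext.mk₀_eq_zero_iff] at this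
    have : f = 0 := by
      have : Epi (q n) := (ModuleCat.epi_iff_surjective _).2 (Submodule.mkQ_surjective _)
      rwa [← cancel_epi (q n), Limits.comp_zero]
    rw [this]; simp
  have : Module.Finite A (Abelian.Ext (ModuleCat.of A A) (ModuleCat.of A N) 0) :=
    inferInstance
  have : Module.Finite A (HH b 0 (ModuleCat.of A N)) := Module.Finite.of_injective F hF
  refine hb _ (fun r hr => ?_) ?_
  · rw [Module.mem_annihilator]
    exact hh_ann r (fun y => Module.mem_annihilator.1 (hN hr) y)
  · obtain ⟨s, hs⟩ := this.fg_top
    choose k hk using fun z : HH b 0 (ModuleCat.of A N) => hh_tors z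
    refine ⟨s.sup k, fun x hx => ?_⟩
    rw [← Submodule.annihilator_top, ← hs, Submodule.mem_annihilator_span]
    rintro ⟨z, hz⟩
    exact hk z x (Ideal.pow_le_pow_right (Finset.le_sup hz) hx)

lemma hh_art [IsNoetherianRing A] (b I : Ideal A) (hb : ArtHyp b I) (i : ℕ) :
    ∀ (N : Type u) [AddCommGroup N] [Module A N] [Module.Finite A N] (_ : I ≤ Module.annihilator A N),
    IsArtinian A (HH b i (ModuleCat.of A N)) := by
  induction i with
  | zero => intro N _ _ _ hN; exact hh_zero_art b I hb N hN
  | succ i ih =>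
    intro N _ _ _ hN
    obtain ⟨G, ⟨k, hk⟩, x, hx, hreg⟩ := exists_gamma b N
    have hQ : I ≤ Module.annihilator A (N ⧸ G) := hN.trans (LinearMap.annihilator_le_of_surjective G.mkQ G.mkQ_surjective)
    have hS := SE_exact (mkQ_exact G) G.injective_subtype G.mkQ_surjective
    have h1 : W b (i+1) (ModuleCat.of A G) := VV_tors b i _ k fun x hx y => Subtype.ext (hk x hx _ y.2)
    have h2 := art_of_ses (i := i+1) hS h1
    suffices IsArtinian A (HH b (i+1) (ModuleCat.of A (N ⧸ G))) from h2 this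
    have hT := hreg.smulShortComplex_shortExact (M := ModuleCat.of A (N ⧸ G))
    have : IsArtinian A (HH b i ((ModuleCat.of A (N ⧸ G)).smulShortComplex x).X₃) := ih (QuotSMulTop x (N ⧸ G)) (hQ.trans (LinearMap.annihilator_le_of_surjective _ (Submodule.mkQ_surjective _)))
    have hr : IsArtinian A (LinearMap.range (hdv b i hT)) :=
      isArtinian_of_surjective _ (hdv b i hT).rangeRestrict (LinearMap.surjective_rangeRestrict _)
    have hle : LinearMap.ker (LinearMap.lsmul A (HH b (i+1) (ModuleCat.of A (N ⧸ G))) x) ≤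
        LinearMap.range (hdv b i hT) := by
      intro z hz
      apply hdv_ker
      refine Eq.trans ?_ hz
      exact hmap_smul x z
    have : IsArtinian A (LinearMap.ker (LinearMap.lsmul A (HH b (i+1) (ModuleCat.of A (N ⧸ G))) x)) :=
      @isArtinian_of_le _ _ _ _ _ _ _ hr hle
    refine melkersson x fun z => ?_
    obtain ⟨n, hn⟩ := hh_tors z
    exact ⟨n, hn _ (Ideal.pow_mem_pow hx n)⟩
end P10

section P11
variable {A : Type u} [CommRing A]

lemma dim_quot [IsLocalRing A] (J : Ideal A) (h : IsLocalRing.maximalIdeal A ≤ J.radical) :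
    Ring.KrullDimLE 0 (A ⧸ J) := by
  rw [Ring.krullDimLE_zero_iff]
  intro P hP
  have h1 : J ≤ P.comap (Ideal.Quotient.mk J) := by
    intro x hx
    rw [Ideal.mem_comap, Ideal.Quotient.eq_zero_iff_mem.2 hx]; exact P.zero_mem
  have hP' : (P.comap (Ideal.Quotient.mk J)).IsPrime := inferInstance
  have h2 : IsLocalRing.maximalIdeal A ≤ P.comap (Ideal.Quotient.mk J) :=
    h.trans (hP'.radical_le_iff.2 h1)
  have h3 := (IsLocalRing.maximalIdeal.isMaximal A).eq_of_le hP'.ne_top h2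
  have : (P.comap (Ideal.Quotient.mk J)).IsMaximal := h3 ▸ IsLocalRing.maximalIdeal.isMaximal A
  have h4 := (Ideal.map_eq_top_or_isMaximal_of_surjective (Ideal.Quotient.mk J) Ideal.Quotient.mk_surjective this)
  rw [Ideal.map_comap_of_surjective _ Ideal.Quotient.mk_surjective] at h4
  exact h4.resolve_left hP.ne_top

lemma le_rad {b I J : Ideal A} {m : Ideal A} (hm : m ≤ (b ⊔ I).radical) (hI : I ≤ J)
    (hb : ∃ k, b ^ k ≤ J) : m ≤ J.radical := by
  refine hm.trans ?_
  rw [← Ideal.radical_idem J]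
  refine Ideal.radical_mono (sup_le ?_ (hI.trans Ideal.le_radical))
  obtain ⟨k, hk⟩ := hb
  intro x hx
  exact ⟨k, hk (Ideal.pow_mem_pow hx k)⟩

lemma artHyp [IsNoetherianRing A] [IsLocalRing A] {b I : Ideal A}
    (hm : IsLocalRing.maximalIdeal A ≤ (b ⊔ I).radical) : ArtHyp b I := by
  intro L _ _ _ hI hb
  have := dim_quot _ (le_rad hm hI hb)
  have : IsArtinianRing (A ⧸ Module.annihilator A L) := isArtinianRing_iff_krullDimLE_zero.2 this
  let : Module (A ⧸ Module.annihilator A L) L := Module.quotientAnnihilator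
  have : IsScalarTower A (A ⧸ Module.annihilator A L) L := ⟨fun r x y => by
    obtain ⟨x, rfl⟩ := Ideal.Quotient.mk_surjective x
    change (r • x) • y = r • x • y
    rw [smul_assoc]⟩
  have : Module.Finite (A ⧸ Module.annihilator A L) L := Module.Finite.of_restrictScalars_finite A _ _
  have : IsArtinian (A ⧸ Module.annihilator A L) L := isArtinian_of_fg_of_artinian'
  exact isArtinian_of_surjective_algebraMap (S := A) (R := A ⧸ Module.annihilator A L) Ideal.Quotient.mk_surjective

lemma hh_smul [IsNoetherianRing A] (b : Ideal A) (g : ℕ) (N : Type u) [AddCommGroup N] [Module A N]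
    [Module.Finite A N] (hN : ∀ i, g + 1 < i → W b i (ModuleCat.of A N)) :
    b • (⊤ : Submodule A (HH b (g+1) (ModuleCat.of A N))) = ⊤ := by
  classical
  rw [eq_top_iff]
  rintro z -
  obtain ⟨n, e, rfl⟩ := hof_surj z
  obtain ⟨s, hs⟩ := IsNoetherian.noetherian b
  let ψ : (s → N) →ₗ[A] N := ∑ j : s, (j : A) • LinearMap.proj j
  have hψ : ∀ x ∈ b, ∀ y : N, x • y ∈ LinearMap.range ψ := by
    intro x hx y
    rw [← hs] at hx
    induction hx using Submodule.span_induction with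
    | mem x hx =>
      refine ⟨Pi.single ⟨x, hx⟩ y, ?_⟩
      simp only [ψ, LinearMap.sum_apply, LinearMap.smul_apply, LinearMap.proj_apply]
      rw [Finset.sum_eq_single ⟨x, hx⟩]
      · simp
      · intro j _ hj; simp [Pi.single_eq_of_ne hj]
      · simp
    | zero => simp
    | add u v _ _ hu hv => rw [add_smul]; exact add_mem hu hv
    | smul r u _ hu => rw [smul_assoc]; exact Submodule.smul_mem _ _ hu
  have hS := SE_exact (mkQ_exact (LinearMap.range ψ)) (LinearMap.range ψ).injective_subtype (LinearMap.range ψ).mkQ_surjective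
  have h3 : W b (g+1) (ModuleCat.of A (N ⧸ LinearMap.range ψ)) := VV_tors b g _ 1 (by
    intro x hx y
    obtain ⟨y, rfl⟩ := Submodule.mkQ_surjective _ y
    rw [pow_one] at hx
    have : (LinearMap.range ψ).mkQ (x • y) = 0 := by
      rw [← LinearMap.mem_ker, Submodule.ker_mkQ]; exact hψ x hx y
    rw [← this, map_smul])
  have hT := SE_exact (ker_exact ψ) (LinearMap.ker ψ).injective_subtype (LinearMap.surjective_rangeRestrict ψ)
  have hK : W b (g+2) (ModuleCat.of A (LinearMap.ker ψ)) := by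
    refine gruson' b (g+1) N hN (g+2) (Nat.lt_succ_self _) (LinearMap.ker ψ) ?_
    intro r hr
    rw [Module.mem_annihilator] at hr ⊢
    intro y
    ext j
    exact hr _
  obtain ⟨l, hl, h0⟩ := W_iff.1 h3 n (pf e (ModuleCat.ofHom (LinearMap.range ψ).mkQ))
  rw [tr_pf] at h0
  obtain ⟨e1, he1⟩ := cov_ex2 hS _ h0
  obtain ⟨m, hm, h0'⟩ := W_iff.1 hK l (dv hT e1)
  rw [tr_dv] at h0'
  obtain ⟨e2, he2⟩ := cov_ex3 hT _ h0'
  have key : tr b (hl.trans hm) e = ∑ j : s, (j : A) • pf e2 (ModuleCat.ofHom (LinearMap.proj j)) := by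
    rw [← tr_tr hl hm, ← he1, tr_pf, ← he2, pf_pf]
    have : (SE _ _ (ker_exact ψ)).g ≫ (SE _ _ (mkQ_exact (LinearMap.range ψ))).f =
      ∑ j : s, (j : A) • (ModuleCat.ofHom (LinearMap.proj (R := A) (φ := fun _ : s => N) j)) := by
      apply ModuleCat.hom_ext
      apply LinearMap.ext
      intro x
      change ψ x = _
      rw [ModuleCat.hom_sum]
      simp [ψ]
    rw [this, pf_sum]
    exact Finset.sum_congr rfl fun j _ => smul_pf _ _ _
  rw [← hof_tr (hl.trans hm), key, map_sum]
  refine Submodule.sum_mem _ fun j _ => ?_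
  rw [map_smul]
  exact Submodule.smul_mem_smul (hs ▸ Submodule.subset_span j.2) trivial

lemma W_zero_of_reg (b : Ideal A) (Q : Type u) [AddCommGroup Q] [Module A Q] (x : A) (hx : x ∈ b)
    (hr : IsSMulRegular Q x) : W b 0 (ModuleCat.of A Q) := by
  rw [W_iff]
  intro n e
  refine ⟨n, le_rfl, ?_⟩
  rw [tr_self]
  obtain ⟨f, rfl⟩ := (Abelian.Ext.mk₀_bijective _ _).2 e
  have : f = 0 := by
    apply ModuleCat.hom_ext
    apply LinearMap.ext
    intro y
    apply hr.pow n
    change x ^ n • f.hom y = x ^ n • (0 : Q)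
    rw [smul_zero, ← map_smul]
    obtain ⟨y, rfl⟩ := Ideal.Quotient.mk_surjective y
    have : x ^ n • (Ideal.Quotient.mk (b ^ n) y) = 0 := by
      rw [Algebra.smul_def]
      change (Ideal.Quotient.mk (b ^ n) (x ^ n)) * _ = 0
      rw [Ideal.Quotient.eq_zero_iff_mem.2 (Ideal.pow_mem_pow hx n), zero_mul]
    exact (congrArg f.hom this).trans (map_zero _)
  rw [this]; simp

lemma W_zero_tors (b : Ideal A) (L : Type u) [AddCommGroup L] [Module A L] (h : W b 0 (ModuleCat.of A L))
    (hb : ∀ x ∈ b, ∀ y : L, x • y = 0) (y : L) : y = 0 := by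
  let f : (A ⧸ b ^ 1) →ₗ[A] L := Submodule.liftQ (b ^ 1) (LinearMap.toSpanSingleton A L y) (by
    intro x hx
    rw [pow_one] at hx
    exact hb x hx y)
  obtain ⟨l, hl, h0⟩ := W_iff.1 h 1 (Abelian.Ext.mk₀ (ModuleCat.ofHom f))
  simp only [tr, pb, Abelian.Ext.mk₀_comp_mk₀] at h0
  rw [Abelian.Ext.mk₀_eq_zero_iff] at h0
  have h1 := congrArg (fun k => k.hom (Ideal.Quotient.mk (b ^ l) 1)) h0
  have h2 : f (Ideal.Quotient.mk (b ^ 1) 1) = 0 := h1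
  have h3 : f (Ideal.Quotient.mk (b ^ 1) 1) = y := one_smul A y
  rw [← h3, h2]

theorem core [IsNoetherianRing A] [IsLocalRing A] (b I : Ideal A) (hbm : b ≤ IsLocalRing.maximalIdeal A)
    (hm : IsLocalRing.maximalIdeal A ≤ (b ⊔ I).radical) (g : ℕ) :
    ∀ (N : Type u) [AddCommGroup N] [Module A N] [Module.Finite A N], I ≤ Module.annihilator A N →
      (∀ i, g < i → W b i (ModuleCat.of A N)) → Module.supportDim A N ≤ g := by
  induction g with
  | zero =>
    intro N _ _ _ hI hN
    obtain ⟨G, ⟨k, hk⟩, x, hx, hreg⟩ := exists_gamma b N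
    have hQ : Module.annihilator A N ≤ Module.annihilator A (N ⧸ G) :=
      LinearMap.annihilator_le_of_surjective G.mkQ G.mkQ_surjective
    have h0 := W_zero_of_reg b (N ⧸ G) x hx hreg
    let m := IsLocalRing.maximalIdeal A
    have h1 := gruson b 0 (N ⧸ G) h0 (fun L _ _ _ hL => gruson' b 0 N hN 1 Nat.one_pos L (hQ.trans hL))
      ((N ⧸ G) ⧸ (m • (⊤ : Submodule A (N ⧸ G))))
      (LinearMap.annihilator_le_of_surjective _ (Submodule.mkQ_surjective _))
    have h2 := W_zero_tors b _ h1 (by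
      intro x hx y
      obtain ⟨y, rfl⟩ := Submodule.mkQ_surjective _ y
      rw [← map_smul, ← LinearMap.mem_ker, Submodule.ker_mkQ]
      exact Submodule.smul_mem_smul (hbm hx) trivial)
    have h3 : (⊤ : Submodule A (N ⧸ G)) ≤ m • (⊤ : Submodule A (N ⧸ G)) := by
      intro y _
      rw [← Submodule.ker_mkQ (m • (⊤ : Submodule A (N ⧸ G)))]
      exact h2 _
    have h4 : (⊤ : Submodule A (N ⧸ G)) = ⊥ :=
      Submodule.eq_bot_of_le_smul_of_le_jacobson_bot m _ (Module.Finite.fg_top) h3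
        (IsLocalRing.maximalIdeal_le_jacobson _)
    have h5 : G = ⊤ := by
      rw [eq_top_iff]
      intro y _
      rw [← Submodule.ker_mkQ G, LinearMap.mem_ker]
      have : G.mkQ y ∈ (⊤ : Submodule A (N ⧸ G)) := trivial
      rwa [h4] at this
    have h6 := dim_quot _ (le_rad hm hI ⟨k, fun x hx => Module.mem_annihilator.2 fun y => hk x hx y (h5 ▸ trivial)⟩)
    rw [Module.supportDim_eq_ringKrullDim_quotient_annihilator]
    exact Order.krullDimLE_iff _ _ |>.1 h6
  | succ g ih =>
    intro N _ _ _ hI hN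
    have := hh_art b I (artHyp hm) (g+1) N hI
    obtain ⟨x, hx, hsurj⟩ := exists_surj b (hh_smul b g N hN)
    refine (Module.supportDim_le_supportDim_quotSMulTop_succ (hbm hx)).trans ?_
    have hQ : Module.annihilator A N ≤ Module.annihilator A (QuotSMulTop x N) :=
      LinearMap.annihilator_le_of_surjective _ (Submodule.mkQ_surjective _)
    have := ih (QuotSMulTop x N) (hI.trans hQ) ?_
    · push_cast
      gcongr
    intro i hi
    rcases Nat.lt_or_ge (g+1) i with h | h
    · exact gruson' b (g+1) N hN i h _ hQ
    obtain rfl : i = g + 1 := by omega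
    let P : Submodule A N := Submodule.map (LinearMap.lsmul A N x) ⊤
    have hS := SE_exact (mkQ_exact P) P.injective_subtype P.mkQ_surjective
    have hP : W b (g+2) (ModuleCat.of A P) := gruson' b (g+1) N hN (g+2) (Nat.lt_succ_self _) P
      (LinearMap.annihilator_le_of_injective P.subtype P.injective_subtype)
    suffices H : W b (g+1) (ModuleCat.of A (N ⧸ P)) from H
    rw [W_iff]
    intro n e
    obtain ⟨l, hl, h0⟩ := W_iff.1 hP n (dv hS e)
    rw [tr_dv] at h0
    obtain ⟨e1, he1⟩ := cov_ex3 hS _ h0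
    obtain ⟨z, hz⟩ := hsurj (hof b (g+1) (ModuleCat.of A N) l e1)
    obtain ⟨n', e2, rfl⟩ := hof_surj z
    have h1 : hof b (g+1) (ModuleCat.of A N) (max l n')
        (tr b (le_max_left l n') e1 - x • tr b (le_max_right l n') e2) = 0 := by
      rw [map_sub, map_smul, hof_tr, hof_tr, hz, sub_self]
    obtain ⟨k, hk, h2⟩ := hof_zero h1
    rw [tr_sub, tr_smul, sub_eq_zero, tr_tr, tr_tr] at h2
    refine ⟨k, hl.trans ((le_max_left l n').trans hk), ?_⟩
    rw [← tr_tr hl ((le_max_left l n').trans hk), ← he1, tr_pf, h2, pf_smul]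
    refine smul_eq_zero_right x ?_ _
    intro y
    obtain ⟨y, rfl⟩ := Submodule.mkQ_surjective P y
    have : P.mkQ (x • y) = 0 := by
      rw [← LinearMap.mem_ker, Submodule.ker_mkQ]; exact ⟨y, trivial, rfl⟩
    rw [← this, map_smul]
end P11

section P12
variable {A : Type u} [CommRing A]

lemma ext_vanish (a : Ideal A) (M : Type u) [AddCommGroup M] [Module A M] (i : ℕ) (h : ¬ Nontrivial (relExt A a i M)) :
    Subsingleton (Abelian.Ext (ModuleCat.of A (A ⧸ a)) (ModuleCat.of A M) i) := by
  rw [not_nontrivial_iff_subsingleton] at h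
  have := (cmp_subsingleton i).1 h
  exact ⟨fun e e' => by rw [this e, this e']⟩

lemma supp_quot (a : Ideal A) : Module.support A (A ⧸ a) = PrimeSpectrum.zeroLocus a := by
  rw [Module.support_eq_zeroLocus, Ideal.annihilator_quotient]

lemma exists_seq [IsNoetherianRing A] (a : Ideal A) (M : Type u) [AddCommGroup M] [Module A M] [Module.Finite A M]
    (hne : a • (⊤ : Submodule A M) ≠ ⊤) (g : ℕ) (h : ∀ i < g, ¬ Nontrivial (relExt A a i M)) :
    ∃ rs : List A, rs.length = g ∧ (∀ r ∈ rs, r ∈ a) ∧ RingTheory.Sequence.IsRegular M rs :=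
  ModuleCat.exists_isRegular_of_exists_subsingleton_ext a g (ModuleCat.of A M) (lt_top_iff_ne_top.2 hne)
    (ModuleCat.of A (A ⧸ a)) (supp_quot a) (fun i hi => ext_vanish a M i (h i hi))

lemma len_le [IsNoetherianRing A] [IsLocalRing A] (N : Type u) [AddCommGroup N] [Module A N] [Module.Finite A N]
    [Nontrivial N] (rs : List A) (reg : RingTheory.Sequence.IsRegular N rs) :
    ((rs.length : ℕ) : WithBot ℕ∞) ≤ Module.supportDim A N := by
  have h := Module.supportDim_add_length_eq_supportDim_of_isRegular rs reg
  have h0 : Module.supportDim A N ≠ ⊥ := Module.supportDim_ne_bot_of_nontrivial A N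
  rw [← h] at h0 ⊢
  refine le_add_of_nonneg_left ?_
  generalize Module.supportDim A (N ⧸ Ideal.ofList rs • (⊤ : Submodule A N)) = d at *
  induction d with
  | bot => simp at h0
  | coe x => exact_mod_cast (zero_le : (0 : ℕ∞) ≤ x)

lemma local_end [IsNoetherianRing A] [IsLocalRing A] (N : Type u) [AddCommGroup N] [Module A N] [Module.Finite A N]
    [Nontrivial N] (rs : List A) (hrs : ∀ r ∈ rs, r ∈ IsLocalRing.maximalIdeal A)
    (reg : RingTheory.Sequence.IsRegular N rs)
    (hd : Module.supportDim A N ≤ (rs.length : ℕ)) :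
    ((rgrade A (IsLocalRing.maximalIdeal A) N : ℕ) : WithBot ℕ∞) = Module.supportDim A N := by
  have hdim := le_antisymm hd (len_le N rs reg)
  have hne : IsLocalRing.maximalIdeal A • (⊤ : Submodule A N) ≠ ⊤ := by
    intro h
    have h4 : (⊤ : Submodule A N) = ⊥ :=
      Submodule.eq_bot_of_le_smul_of_le_jacobson_bot _ _ (Module.Finite.fg_top) h.ge
        (IsLocalRing.maximalIdeal_le_jacobson _)
    exact top_ne_bot h4
  have h1 : ∀ i < rs.length, ¬ Nontrivial (relExt A (IsLocalRing.maximalIdeal A) i N) := by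
    intro i hi
    rw [not_nontrivial_iff_subsingleton]
    refine (cmp_subsingleton i).2 fun e => ?_
    have := ModuleCat.subsingleton_ext_of_exists_isRegular (IsLocalRing.maximalIdeal A)
      (ModuleCat.of A (A ⧸ IsLocalRing.maximalIdeal A)) (supp_quot _).le (ModuleCat.of A N)
      (lt_top_iff_ne_top.2 hne) rs hrs reg i hi
    exact Subsingleton.elim _ _
  have h2 : Nontrivial (relExt A (IsLocalRing.maximalIdeal A) rs.length N) := by
    by_contra hcon
    obtain ⟨rs', hl, -, reg'⟩ := exists_seq (IsLocalRing.maximalIdeal A) N hne (rs.length + 1) (by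
      intro i hi
      rcases Nat.lt_succ_iff_lt_or_eq.1 hi with h | rfl
      · exact h1 i h
      · exact hcon)
    have := len_le N rs' reg'
    rw [hl, hdim] at this
    have : rs.length + 1 ≤ rs.length := by exact_mod_cast this
    omega
  rw [hdim]
  have : rgrade A (IsLocalRing.maximalIdeal A) N = rs.length := by
    refine le_antisymm (Nat.sInf_le h2) ?_
    refine le_csInf ⟨_, h2⟩ fun i hi => ?_
    by_contra hlt
    exact h1 i (not_le.1 hlt) hi
  rw [this]

lemma W_of_rcd [IsNoetherianRing A] (a : Ideal A) (M : Type u) [AddCommGroup M] [Module A M] (i : ℕ)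
    (hi : rcd A a M < i) : W a i (ModuleCat.of A M) := by
  apply localCoh_subsingleton_imp
  rw [← not_nontrivial_iff_subsingleton]
  intro hn
  obtain ⟨r, hr⟩ := VV_bound a
  have hbd : BddAbove {i | Nontrivial (localCoh A a i M)} := by
    refine ⟨r, fun j hj => ?_⟩
    by_contra hlt
    exact not_nontrivial_iff_subsingleton.2 (localCoh_subsingleton_of a j M (hr j (not_le.1 hlt) _)) hj
  exact absurd (le_csSup hbd hn) (not_le.2 hi)

lemma rad_loc {R : Type u} [CommRing R] (a : Ideal R)
    (M : Type u) [AddCommGroup M] [Module R M] [Module.Finite R M]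
    (p : PrimeSpectrum R)
    (hmin : ∀ q ∈ Module.support R (M ⧸ (a • ⊤ : Submodule R M)), q ≤ p → q = p) :
    IsLocalRing.maximalIdeal (Localization.AtPrime p.asIdeal) ≤
      (a.map (algebraMap R (Localization.AtPrime p.asIdeal)) ⊔
        (Module.annihilator R M).map (algebraMap R (Localization.AtPrime p.asIdeal))).radical := by
  rw [Ideal.radical_eq_sInf]
  refine le_sInf ?_
  rintro Q ⟨hQ, hQp⟩
  let q : PrimeSpectrum R := ⟨Q.comap (algebraMap R (Localization.AtPrime p.asIdeal)), inferInstance⟩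
  have hq : q ∈ Module.support R (M ⧸ (a • ⊤ : Submodule R M)) := by
    rw [Module.support_quotient, Module.support_eq_zeroLocus]
    exact ⟨Ideal.map_le_iff_le_comap.1 (le_sup_right.trans hQ), Ideal.map_le_iff_le_comap.1 (le_sup_left.trans hQ)⟩
  have hle : q ≤ p := by
    change Q.comap _ ≤ p.asIdeal
    exact (Ideal.comap_mono (IsLocalRing.le_maximalIdeal hQp.ne_top)).trans
      (Localization.AtPrime.under_maximalIdeal (I := p.asIdeal)).le
  have h := hmin q hq hle
  rw [← Localization.AtPrime.map_eq_maximalIdeal, Ideal.map_le_iff_le_comap]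
  exact (congrArg PrimeSpectrum.asIdeal h).ge
end P12

/-- localizations of relative Cohen-Macaulay modules at minimal primes of
the support of `M/aM` are Cohen-Macaulay (depth = dimension). -/
theorem stmt2 [IsNoetherianRing R] (a : Ideal R)
    (M : Type u) [AddCommGroup M] [Module R M] [Module.Finite R M]
    (hCM : IsRelCM R a M) (hne : a • (⊤ : Submodule R M) ≠ ⊤)
    (p : PrimeSpectrum R)
    (hp : p ∈ Module.support R (M ⧸ (a • ⊤ : Submodule R M)))
    (hmin : ∀ q ∈ Module.support R (M ⧸ (a • ⊤ : Submodule R M)), q ≤ p → q = p) :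
    ((rgrade (Localization.AtPrime p.asIdeal)
        (IsLocalRing.maximalIdeal (Localization.AtPrime p.asIdeal))
        (LocalizedModule p.asIdeal.primeCompl M) : ℕ) : WithBot ℕ∞) =
      ringKrullDim ((Localization.AtPrime p.asIdeal) ⧸
        Module.annihilator (Localization.AtPrime p.asIdeal)
          (LocalizedModule p.asIdeal.primeCompl M)) := by
  have hg := (hCM.resolve_left hne).2
  have hs := hp
  rw [Module.support_quotient] at hs
  have hap : a ≤ p.asIdeal := hs.2
  have : Nontrivial (LocalizedModule p.asIdeal.primeCompl M) := Module.mem_support_iff.1 hs.1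
  have : IsNoetherianRing (Localization.AtPrime p.asIdeal) :=
    IsLocalization.isNoetherianRing p.asIdeal.primeCompl _ inferInstance
  have : Module.Finite (Localization.AtPrime p.asIdeal) (LocalizedModule p.asIdeal.primeCompl M) :=
    Module.Finite.of_isLocalizedModule p.asIdeal.primeCompl (LocalizedModule.mkLinearMap p.asIdeal.primeCompl M)
  obtain ⟨rs, hl, hrs, reg⟩ := exists_seq a M hne (rgrade R a M) (fun i hi => Nat.notMem_of_lt_sInf hi)
  have reg' := reg.1.isRegular_of_isLocalizedModule_of_mem (Localization.AtPrime p.asIdeal) p.asIdeal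
    (LocalizedModule.mkLinearMap p.asIdeal.primeCompl M) (fun r hr => hap (hrs r hr))
  have hmap : ∀ I : Ideal R, I ≤ p.asIdeal → I.map (algebraMap R (Localization.AtPrime p.asIdeal)) ≤
      IsLocalRing.maximalIdeal (Localization.AtPrime p.asIdeal) := by
    intro I hI
    rw [← Localization.AtPrime.map_eq_maximalIdeal]
    exact Ideal.map_mono hI
  rw [← Module.supportDim_eq_ringKrullDim_quotient_annihilator]
  refine local_end _ (rs.map (algebraMap R (Localization.AtPrime p.asIdeal))) ?_ reg' ?_
  · intro r hr
    obtain ⟨r', hr', rfl⟩ := List.mem_map.1 hr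
    exact hmap a hap (Ideal.mem_map_of_mem _ (hrs r' hr'))
  · rw [List.length_map, hl]
    refine core _ _ (hmap a hap) (rad_loc a M p hmin) _ _ ?_ ?_
    · rw [Ideal.map_le_iff_le_comap]
      intro r hr
      rw [Ideal.mem_comap, Module.mem_annihilator]
      intro z
      induction z using LocalizedModule.induction_on with
      | h m s =>
        rw [algebraMap_smul, LocalizedModule.smul'_mk, Module.mem_annihilator.1 hr m, LocalizedModule.zero_mk]
    · intro i hi
      exact W_loc p.asIdeal.primeCompl a i M (W_of_rcd a M i (hg ▸ hi))
end

section
/- Let 𝔞 be an ideal of R contained in its Jacobson radical and M a nonzero finitely generated R-module with cd(𝔞,M) = 0. Then M is 𝔞-torsion, i.e., M = Γ_𝔞(M). -/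
open CategoryTheory Opposite
open scoped TensorProduct

universe u

variable (R : Type u) [CommRing R]

namespace LC
open CategoryTheory.Limits

section homological
variable {D : Type*} [Category* D] [Abelian D]

lemma factor_of_zero (K : ChainComplex D ℕ) (p : ℕ) {J : D} [Injective J]
    (k : K.X (p+1) ⟶ J) (hk : K.d (p+2) (p+1) ≫ k = 0)
    (h : K.homologyι (p+1) ≫ K.descOpcycles k (p+2) (by simp) hk = 0) :
    ∃ g : K.X p ⟶ J, K.d (p+1) p ≫ g = k := by
  have hker := K.homologyIsKernel (p+1) p (by simp)
  let S : ShortComplex D := ShortComplex.mk (K.homologyι (p+1)) (K.fromOpcycles (p+1) p)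
    (K.homologyι_comp_fromOpcycles _ _)
  have hS : S.Exact := ShortComplex.exact_of_f_is_kernel S hker
  refine ⟨hS.descToInjective _ h, ?_⟩
  have := hS.comp_descToInjective _ h
  rw [← K.p_fromOpcycles, Category.assoc]
  erw [this]
  simp

lemma class_naturality {K L : ChainComplex D ℕ} (φ : K ⟶ L) (n : ℕ) {J : D}
    (k : L.X n ⟶ J) (hk : L.d (n+1) n ≫ k = 0) :
    HomologicalComplex.homologyMap φ n ≫ L.homologyι n ≫ L.descOpcycles k (n+1) (by simp) hk =
      K.homologyι n ≫ K.descOpcycles (φ.f n ≫ k) (n+1) (by simp)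
        (by rw [← φ.comm_assoc, hk, comp_zero]) := by
  rw [HomologicalComplex.homologyι_naturality_assoc,
    HomologicalComplex.opcyclesMap_comp_descOpcycles]

end homological

variable {R}

abbrev MC (R : Type u) [CommRing R] := ModuleCat.{u} R

noncomputable abbrev Yo (Y : MC R) : MC R ⥤ (MC R)ᵒᵖ := ((linearYoneda R (MC R)).obj Y).rightOp

/-- a hom as a map out of `R`, in the opposite category -/
noncomputable def toOp {X Y : MC R} (f : X ⟶ Y) : (Yo Y).obj X ⟶ op (ModuleCat.of R R) :=
  Quiver.Hom.op (ModuleCat.ofHom (LinearMap.toSpanSingleton R (X ⟶ Y) f))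

lemma toOp_apply {X Y : MC R} (f : X ⟶ Y) : (toOp f).unop.hom (1:R) = f :=
  one_smul R f

lemma op_ext {X Y : MC R} {k l : (Yo Y).obj X ⟶ op (ModuleCat.of R R)}
    (h : k.unop.hom (1:R) = l.unop.hom (1:R)) : k = l := by
  apply Quiver.Hom.unop_inj
  apply ModuleCat.hom_ext
  apply LinearMap.ext_ring
  exact h

lemma map_toOp {X' X Y : MC R} (g : X' ⟶ X) (f : X ⟶ Y) :
    (Yo Y).map g ≫ toOp f = toOp (g ≫ f) := by
  apply op_ext
  rw [toOp_apply]
  exact congrArg (fun z => g ≫ z) (toOp_apply f)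

lemma toOp_zero {X Y : MC R} : toOp (0 : X ⟶ Y) = 0 := by
  apply op_ext
  rw [toOp_apply]
  rfl

lemma toOp_surj {X Y : MC R} (k : (Yo Y).obj X ⟶ op (ModuleCat.of R R)) :
    ∃ f : X ⟶ Y, toOp f = k :=
  ⟨k.unop.hom (1:R), op_ext (toOp_apply _)⟩

lemma toOp_inj {X Y : MC R} {f g : X ⟶ Y} (h : toOp f = toOp g) : f = g := by
  rw [← toOp_apply f, h, toOp_apply]

instance : Injective (op (ModuleCat.of R R) : (MC R)ᵒᵖ) := by
  have : Projective (ModuleCat.of R R) := ModuleCat.projective_of_free (Module.Basis.singleton Unit R)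
  infer_instance

/-- class of a cocycle in the old Ext (morphism in the opposite category) -/
noncomputable def cls {X Y : MC R} (P : ProjectiveResolution X) (n : ℕ) (f : P.complex.X n ⟶ Y)
    (hf : P.complex.d (n+1) n ≫ f = 0) :
    ((Yo Y).leftDerived n).obj X ⟶ op (ModuleCat.of R R) :=
  (P.isoLeftDerivedObj (Yo Y) n).hom ≫
    (((Yo Y).mapHomologicalComplex _).obj P.complex).homologyι n ≫
    (((Yo Y).mapHomologicalComplex _).obj P.complex).descOpcycles (toOp f) (n+1) (by simp)
      (by
        have := map_toOp (P.complex.d (n+1) n) f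
        rw [hf, toOp_zero] at this
        exact this)

lemma cls_map {X X' Y : MC R} (P : ProjectiveResolution X) (P' : ProjectiveResolution X')
    (g : X' ⟶ X) (φ : ProjectiveResolution.Hom P' P g) (n : ℕ) (f : P.complex.X n ⟶ Y)
    (hf : P.complex.d (n+1) n ≫ f = 0) (hf' : P'.complex.d (n+1) n ≫ φ.hom.f n ≫ f = 0) :
    ((Yo Y).leftDerived n).map g ≫ cls P n f hf = cls P' n (φ.hom.f n ≫ f) hf' := by
  unfold cls
  rw [ProjectiveResolution.isoLeftDerivedObj_hom_naturality_assoc g P' P φ.hom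
    (by simpa using φ.hom_f_zero_comp_π_f_zero)]
  congr 1
  have := class_naturality (((Yo Y).mapHomologicalComplex (ComplexShape.down ℕ)).map φ.hom) n (toOp f)
    (by
        have := map_toOp (P.complex.d (n+1) n) f
        rw [hf, toOp_zero] at this
        exact this)
  refine this.trans ?_
  congr 2

lemma cls_zero {X Y : MC R} (P : ProjectiveResolution X) (p : ℕ) (f : P.complex.X (p+1) ⟶ Y)
    (hf : P.complex.d (p+2) (p+1) ≫ f = 0) (h : cls P (p+1) f hf = 0) :
    ∃ g : P.complex.X p ⟶ Y, P.complex.d (p+1) p ≫ g = f := by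
  unfold cls at h
  rw [Preadditive.IsIso.comp_left_eq_zero] at h
  obtain ⟨k, hk⟩ := factor_of_zero _ _ _ _ h
  obtain ⟨g, rfl⟩ := toOp_surj k
  exact ⟨g, toOp_inj ((map_toOp _ _).symm.trans hk)⟩

/-- R/a^t -/
abbrev Q (a : Ideal R) (t : ℕ) : MC R := ModuleCat.of R (R ⧸ a ^ t)

noncomputable def π (a : Ideal R) {t s : ℕ} (h : t ≤ s) : Q a s ⟶ Q a t :=
  ModuleCat.ofHom (Submodule.mapQ _ _ LinearMap.id (Ideal.pow_le_pow_right h))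

def Vanish (a : Ideal R) (n : ℕ) (M : MC R) : Prop :=
  ∀ (t : ℕ) (e : Abelian.Ext.{u} (Q a t) M n), ∃ (s : ℕ) (h : t ≤ s),
    (Abelian.Ext.mk₀ (π a h)).comp e (zero_add n) = 0

lemma vanish_of_localCoh (a : Ideal R) (p : ℕ) (M : Type u) [AddCommGroup M] [Module R M]
    (h : Subsingleton (localCoh R a (p+1) M)) : Vanish a (p+1) (ModuleCat.of R M) := by
  intro t e
  let P : ∀ t, ProjectiveResolution (Q a t) := fun t => projectiveResolution (Q a t)
  obtain ⟨f, hf, rfl⟩ := (P t).extMk_surjective e (p+2) rfl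
  let Fd := localCohomology.diagram (localCohomology.idealPowersDiagram a) (p+1)
  have hcol := isColimitOfPreserves ((evaluation _ _).obj (ModuleCat.of R M))
    (colimit.isColimit Fd)
  let c := cls (P t) (p+1) f hf
  let x : ((Fd ⋙ (evaluation _ _).obj (ModuleCat.of R M)).obj (op (op t))) := c.unop.hom (1:R)
  have hsub : Subsingleton ((((evaluation _ _).obj (ModuleCat.of R M)).mapCocone (colimit.cocone Fd)).pt : MC R) := h
  have : PreservesFilteredColimitsOfSize.{0, 0} (forget (MC R)) :=
    preservesFilteredColimitsOfSize_shrink.{0, u, 0, u} _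
  obtain ⟨k, i, j, hij⟩ := Concrete.isColimit_exists_of_rep_eq _ hcol x (0 : ((Fd ⋙ (evaluation _ _).obj (ModuleCat.of R M)).obj (op (op t)))) (hsub.elim _ _)
  obtain ⟨⟨s⟩⟩ := k
  have hts : t ≤ s := leOfHom i.unop.unop
  refine ⟨s, hts, ?_⟩
  let φ : ProjectiveResolution.Hom (P s) (P t) (π a hts) :=
    ⟨ProjectiveResolution.lift (π a hts) (P s) (P t),
      ProjectiveResolution.lift_commutes_zero _ _ _⟩
  rw [ProjectiveResolution.mk₀_comp_extMk _ _ _ _ φ, ProjectiveResolution.extMk_eq_zero_iff _ _ _ _ _ p rfl]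
  have hf' : (P s).complex.d (p + 1 + 1) (p + 1) ≫ φ.hom.f (p + 1) ≫ f = 0 := by
    rw [← φ.hom.comm_assoc, hf, comp_zero]
  refine cls_zero (P s) p _ hf' ?_
  rw [← cls_map (P t) (P s) (π a hts) φ (p+1) f hf hf']
  apply Quiver.Hom.unop_inj
  apply ModuleCat.hom_ext
  apply LinearMap.ext_ring
  rw [map_zero] at hij
  exact hij


open Abelian (Ext)

lemma π_comp (a : Ideal R) {t s r : ℕ} (h : t ≤ s) (h' : s ≤ r) :
    π a h' ≫ π a h = π a (h.trans h') := by
  apply ModuleCat.hom_ext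
  apply LinearMap.ext
  intro x
  obtain ⟨x, rfl⟩ := Submodule.Quotient.mk_surjective _ x
  rfl

lemma π_π (a : Ideal R) {t s r : ℕ} (h : t ≤ s) (h' : s ≤ r) {M : MC R} {n : ℕ}
    (e : Abelian.Ext.{u} (Q a t) M n) :
    (Abelian.Ext.mk₀ (π a h')).comp ((Abelian.Ext.mk₀ (π a h)).comp e (zero_add n)) (zero_add n) =
      (Abelian.Ext.mk₀ (π a (h.trans h'))).comp e (zero_add n) := by
  rw [Abelian.Ext.mk₀_comp_mk₀_assoc, π_comp]

lemma vanish₃ (a : Ideal R) {S : ShortComplex (MC R)} (hS : S.ShortExact) {n : ℕ}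
    (h2 : Vanish a n S.X₂) (h1 : Vanish a (n+1) S.X₁) : Vanish a n S.X₃ := by
  intro t e
  obtain ⟨s, hs, h⟩ := h1 t (e.comp hS.extClass rfl)
  rw [← Abelian.Ext.comp_assoc _ _ _ (zero_add n) rfl (by omega)] at h
  obtain ⟨e2, he2⟩ := Abelian.Ext.covariant_sequence_exact₃ _ hS _ _ h
  obtain ⟨r, hr, h'⟩ := h2 s e2
  refine ⟨r, hs.trans hr, ?_⟩
  rw [← π_π a hs hr, ← he2, ← Abelian.Ext.comp_assoc _ _ _ (zero_add n) (add_zero n) (by omega), h',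
    Abelian.Ext.zero_comp]

lemma vanish₁ (a : Ideal R) {S : ShortComplex (MC R)} (hS : S.ShortExact) {n : ℕ}
    (h3 : Vanish a n S.X₃) (h2 : Vanish a (n+1) S.X₂) : Vanish a (n+1) S.X₁ := by
  intro t e
  obtain ⟨s, hs, h⟩ := h2 t (e.comp (Abelian.Ext.mk₀ S.f) (add_zero _))
  rw [← Abelian.Ext.comp_assoc _ _ _ (zero_add (n+1)) (add_zero _) (by omega)] at h
  obtain ⟨e3, he3⟩ := Abelian.Ext.covariant_sequence_exact₁ _ hS _ h rfl
  obtain ⟨r, hr, h'⟩ := h3 s e3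
  refine ⟨r, hs.trans hr, ?_⟩
  rw [← π_π a hs hr, ← he3, ← Abelian.Ext.comp_assoc _ _ _ (zero_add n) rfl (by omega), h',
    Abelian.Ext.zero_comp]

/-- torsion -/
def Tor (a : Ideal R) (M : Type*) [AddCommGroup M] [Module R M] : Prop :=
  ∀ m : M, ∃ n : ℕ, ∀ r ∈ a ^ n, r • m = 0

/-- torsion submodule -/
def Gam (a : Ideal R) (M : Type*) [AddCommGroup M] [Module R M] : Submodule R M where
  carrier := {m | ∃ n : ℕ, ∀ r ∈ a ^ n, r • m = 0}
  zero_mem' := ⟨0, fun r _ => smul_zero r⟩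
  add_mem' := by
    rintro x y ⟨n, hn⟩ ⟨k, hk⟩
    refine ⟨max n k, fun r hr => ?_⟩
    rw [smul_add, hn r (Ideal.pow_le_pow_right (le_max_left _ _) hr),
      hk r (Ideal.pow_le_pow_right (le_max_right _ _) hr), add_zero]
  smul_mem' := by
    rintro c x ⟨n, hn⟩
    exact ⟨n, fun r hr => by rw [smul_comm, hn r hr, smul_zero]⟩

lemma tor_gam (a : Ideal R) (M : Type*) [AddCommGroup M] [Module R M] : Tor a (Gam a M) := by
  rintro ⟨m, n, hn⟩
  exact ⟨n, fun r hr => Subtype.ext (hn r hr)⟩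

lemma tor_submodule {a : Ideal R} {M : Type*} [AddCommGroup M] [Module R M] (h : Tor a M)
    (N : Submodule R M) : Tor a N := by
  rintro ⟨m, hm⟩
  obtain ⟨n, hn⟩ := h m
  exact ⟨n, fun r hr => Subtype.ext (hn r hr)⟩

lemma tor_quot {a : Ideal R} {M N : Type*} [AddCommGroup M] [Module R M] [AddCommGroup N] [Module R N]
    (f : M →ₗ[R] N) (hf : Function.Surjective f) (h : Tor a M) : Tor a N := by
  intro y
  obtain ⟨x, rfl⟩ := hf y
  obtain ⟨n, hn⟩ := h x
  exact ⟨n, fun r hr => by rw [← map_smul, hn r hr, map_zero]⟩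

/-- uniform annihilation -/
lemma unif {a : Ideal R} {M : Type*} [AddCommGroup M] [Module R M] (N : Submodule R M)
    (hN : N.FG) (h : N ≤ Gam a M) : ∃ k : ℕ, ∀ r ∈ a ^ k, ∀ m ∈ N, r • m = 0 := by
  obtain ⟨s, rfl⟩ := hN
  have h' : ∀ x ∈ s, ∃ n : ℕ, ∀ r ∈ a ^ n, r • x = 0 := fun x hx => h (Submodule.subset_span hx)
  choose! f hf using h'
  refine ⟨s.sup f, fun r hr m hm => ?_⟩
  induction hm using Submodule.span_induction with
  | mem x hx => exact hf x hx r (Ideal.pow_le_pow_right (Finset.le_sup hx) hr)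
  | zero => exact smul_zero _
  | add x y _ _ hx hy => rw [smul_add, hx, hy, add_zero]
  | smul c x _ hx => rw [smul_comm, hx, smul_zero]

/-- map from R/a^t determined by an element -/
noncomputable def elt {a : Ideal R} {t : ℕ} {M : Type u} [AddCommGroup M] [Module R M] (m : M)
    (h : ∀ r ∈ a ^ t, r • m = 0) : Q a t ⟶ ModuleCat.of R M :=
  ModuleCat.ofHom (Submodule.liftQ (a ^ t) (LinearMap.toSpanSingleton R M m) (fun r hr => h r hr))

lemma elt_one {a : Ideal R} {t : ℕ} {M : Type u} [AddCommGroup M] [Module R M] (m : M)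
    (h : ∀ r ∈ a ^ t, r • m = 0) : (elt m h).hom (Submodule.Quotient.mk (1:R)) = m :=
  one_smul R m

lemma q_ext {a : Ideal R} {t : ℕ} {M : MC R} {f g : Q a t ⟶ M}
    (h : f.hom (Submodule.Quotient.mk (1:R)) = g.hom (Submodule.Quotient.mk (1:R))) : f = g := by
  apply ModuleCat.hom_ext
  apply Submodule.linearMap_qext
  apply LinearMap.ext_ring
  exact h

lemma q_kill {a : Ideal R} {t : ℕ} {M : MC R} (f : Q a t ⟶ M) :
    ∀ r ∈ a ^ t, r • f.hom (Submodule.Quotient.mk (1:R)) = 0 := by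
  intro r hr
  rw [← map_smul, ← Submodule.Quotient.mk_smul, smul_eq_mul, mul_one,
    (Submodule.Quotient.mk_eq_zero (a ^ t)).mpr hr, map_zero]

lemma gam_baer [IsNoetherianRing R] (a : Ideal R) (E : Type u) [AddCommGroup E] [Module R E]
    (hE : Module.Baer R E) : Module.Baer R (Gam a E) := by
  intro I f
  obtain ⟨k, hk⟩ := unif (a := a) (LinearMap.range ((Gam a E).subtype ∘ₗ f))
    (by rw [LinearMap.range_eq_map]; exact Module.Finite.fg_top.map _)
    (by rintro _ ⟨x, rfl⟩; exact (f x).2)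
  obtain ⟨c, hc⟩ := Ideal.exists_pow_inf_eq_pow_smul a (I : Submodule R R)
  have key : ∀ (x : R) (hx : x ∈ I), x ∈ a ^ (c + k) → (f ⟨x, hx⟩ : E) = 0 := by
    intro x hx hxa
    have h1 : x ∈ a ^ (c + k) • (⊤ : Submodule R R) ⊓ I := ⟨by simpa using hxa, hx⟩
    rw [hc _ (Nat.le_add_right c k), Nat.add_sub_cancel_left] at h1
    have h2 : ∃ hx' : x ∈ I, (f ⟨x, hx'⟩ : E) = 0 := by
      clear hx hxa
      refine Submodule.smul_induction_on h1 ?_ ?_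
      · intro r hr n hn
        refine ⟨I.mul_mem_left r hn.2, ?_⟩
        exact (congrArg Subtype.val (map_smul f r ⟨n, hn.2⟩)).trans
          (hk r hr _ ⟨⟨n, hn.2⟩, rfl⟩)
      · rintro x y ⟨h1, h1'⟩ ⟨h2, h2'⟩
        refine ⟨I.add_mem h1 h2, ?_⟩
        refine (congrArg Subtype.val (map_add f ⟨x, h1⟩ ⟨y, h2⟩)).trans ?_
        change (f ⟨x, h1⟩ : E) + (f ⟨y, h2⟩ : E) = 0
        rw [h1', h2', add_zero]
    exact h2.2
  let F : R →ₗ.[R] E := ⟨I, (Gam a E).subtype ∘ₗ f⟩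
  let G : R →ₗ.[R] E := ⟨a ^ (c + k), 0⟩
  have hFG : ∀ (x : F.domain) (y : G.domain), (x : R) = y → F x = G y := by
    rintro ⟨x, hx⟩ ⟨y, hy⟩ h
    obtain rfl : x = y := h
    exact key x hx hy
  obtain ⟨g, hg⟩ := hE (F.sup G hFG).domain (F.sup G hFG).toFun
  have hgI : ∀ x (hx : x ∈ I), g x = f ⟨x, hx⟩ := by
    intro x hx
    have hle : F ≤ F.sup G hFG := LinearPMap.left_le_sup _ _ _
    rw [hg x (hle.1 hx)]
    exact (hle.2 (x := ⟨x, hx⟩) rfl).symm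
  have hga : ∀ x ∈ a ^ (c + k), g x = 0 := by
    intro x hx
    have hle : G ≤ F.sup G hFG := LinearPMap.right_le_sup _ _ _
    rw [hg x (hle.1 hx)]
    exact (hle.2 (x := ⟨x, hx⟩) rfl).symm
  refine ⟨g.codRestrict (Gam a E) fun x => ⟨c + k, fun r hr => ?_⟩, fun x hx => Subtype.ext (hgI x hx)⟩
  rw [← map_smul, smul_eq_mul]
  exact hga _ (Ideal.mul_mem_right _ _ hr)

lemma vanish_injective (a : Ideal R) (E : MC R) [Injective E] (n : ℕ) : Vanish a (n+1) E :=
  fun t e => ⟨t, le_rfl, by rw [Abelian.Ext.eq_zero_of_injective e, Abelian.Ext.comp_zero]⟩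

/-- embedding into torsion injective -/
lemma exists_emb [IsNoetherianRing R] (a : Ideal R) (T : Type u) [AddCommGroup T] [Module R T]
    (hT : Tor a T) : ∃ (E : Type u) (_ : AddCommGroup E) (_ : Module R E) (f : T →ₗ[R] E),
      Function.Injective f ∧ Tor a E ∧ Injective (ModuleCat.of R E) := by
  obtain ⟨⟨J, hJ, ι, hι⟩⟩ := EnoughInjectives.presentation (ModuleCat.of R T)
  have h1 : Module.Injective R J := Module.injective_module_of_injective_object R J
  have h2 := (gam_baer a J (Module.Baer.of_injective h1)).injective
  refine ⟨Gam a J, inferInstance, inferInstance, ι.hom.codRestrict _ fun x => ?_, ?_, tor_gam a J,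
    Module.injective_object_of_injective_module R _⟩
  · obtain ⟨n, hn⟩ := hT x
    exact ⟨n, fun r hr => by rw [← map_smul, hn r hr, map_zero]⟩
  · rw [ModuleCat.mono_iff_injective] at hι
    intro x y h
    exact hι (congrArg Subtype.val h)

lemma vanish_tor [IsNoetherianRing R] (a : Ideal R) (n : ℕ) : ∀ (T : Type u) [AddCommGroup T]
    [Module R T], Tor a T → Vanish a (n+1) (ModuleCat.of R T) := by
  induction n with
  | zero =>
    intro T _ _ hT
    obtain ⟨E, _, _, f, hf, hE, hi⟩ := exists_emb a T hT
    let S := ModuleCat.shortComplexOfCompEqZero f (LinearMap.range f).mkQ (by ext; simp)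
    have hS : S.ShortExact :=
      { exact := ModuleCat.shortComplex_exact _ (LinearMap.exact_map_mkQ_range f)
        mono_f := (ModuleCat.mono_iff_injective _).mpr hf
        epi_g := (ModuleCat.epi_iff_surjective _).mpr (Submodule.mkQ_surjective _) }
    intro t e
    obtain ⟨e3, rfl⟩ := Abelian.Ext.covariant_sequence_exact₁ _ hS e
      (@Abelian.Ext.eq_zero_of_injective _ _ _ _ _ _ _ hi _) (zero_add 1)
    obtain ⟨g, rfl⟩ := Abelian.Ext.addEquiv₀.symm.surjective e3
    obtain ⟨y, hy⟩ := (LinearMap.range f).mkQ_surjective (g.hom (Submodule.Quotient.mk (1:R)))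
    obtain ⟨s, hs⟩ := hE y
    have hs' : ∀ r ∈ a ^ (max t s), r • y = 0 := fun r hr =>
      hs r (Ideal.pow_le_pow_right (le_max_right _ _) hr)
    refine ⟨max t s, le_max_left _ _, ?_⟩
    have : π a (le_max_left t s) ≫ g = elt y hs' ≫ S.g := by
      apply q_ext
      change g.hom _ = (LinearMap.range f).mkQ ((elt y hs').hom _)
      rw [elt_one, hy]
      rfl
    change (Abelian.Ext.mk₀ _).comp ((Abelian.Ext.mk₀ g).comp _ _) _ = 0
    rw [Abelian.Ext.mk₀_comp_mk₀_assoc, this, ← Abelian.Ext.mk₀_comp_mk₀_assoc, hS.comp_extClass,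
      Abelian.Ext.comp_zero]
  | succ n ih =>
    intro T _ _ hT
    obtain ⟨E, _, _, f, hf, hE, hi⟩ := exists_emb a T hT
    let S := ModuleCat.shortComplexOfCompEqZero f (LinearMap.range f).mkQ (by ext; simp)
    have hS : S.ShortExact :=
      { exact := ModuleCat.shortComplex_exact _ (LinearMap.exact_map_mkQ_range f)
        mono_f := (ModuleCat.mono_iff_injective _).mpr hf
        epi_g := (ModuleCat.epi_iff_surjective _).mpr (Submodule.mkQ_surjective _) }
    exact vanish₁ a hS (ih _ (tor_quot _ (Submodule.mkQ_surjective _) hE))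
      (@vanish_injective _ _ a _ hi _)

open scoped Pointwise in
lemma exists_regular [IsNoetherianRing R] (a : Ideal R) (N : Type u) [AddCommGroup N] [Module R N]
    [Module.Finite R N] (h0 : ∀ y : N, (∀ r ∈ a, r • y = 0) → y = 0) :
    ∃ x ∈ a, IsSMulRegular N x := by
  by_contra! hcon
  have hsub : (a : Set R) ⊆ ⋃ p ∈ ((associatedPrimes.finite R N).toFinset : Set (Ideal R)),
      ((id p : Ideal R) : Set R) := by
    have := biUnion_associatedPrimes_eq_compl_regular R N
    simp only [Set.Finite.coe_toFinset, id]
    rw [this]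
    exact fun x hx => hcon x hx
  obtain ⟨p, hp, hap⟩ := (Ideal.subset_union_prime ⊥ ⊥ (fun i hi _ _ => by
    exact IsAssociatedPrime.isPrime ((Set.Finite.mem_toFinset _).mp hi))).mp hsub
  rw [Set.Finite.mem_toFinset] at hp
  obtain ⟨hpp, y, hy⟩ := isAssociatedPrime_iff.mp hp
  have hy0 : y = 0 := h0 y fun r hr => by
    have : r ∈ p := hap hr
    rw [hy] at this
    simpa [Submodule.mem_colon_singleton] using this
  apply hpp.ne_top
  rw [hy, hy0, Ideal.eq_top_iff_one]
  simp [Submodule.mem_colon_singleton]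

lemma quot_zero (a : Ideal R) {S : ShortComplex (MC R)} (hS : S.ShortExact)
    (h0 : ∀ y : S.X₂, ∀ n : ℕ, (∀ r ∈ a ^ n, r • y = 0) → y = 0)
    (hv : Vanish a 1 S.X₁)
    (q : S.X₃) (t : ℕ) (hq : ∀ r ∈ a ^ t, r • q = 0) : q = 0 := by
  obtain ⟨f, hf⟩ : ∃ f : Q a t ⟶ S.X₃, f.hom (Submodule.Quotient.mk (1:R)) = q :=
    ⟨elt q hq, elt_one q hq⟩
  obtain ⟨s, hs, h⟩ := hv t ((Abelian.Ext.mk₀ f).comp hS.extClass (zero_add 1))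
  rw [Abelian.Ext.mk₀_comp_mk₀_assoc] at h
  obtain ⟨e2, he⟩ := Abelian.Ext.covariant_sequence_exact₃ _ hS _ _ h
  obtain ⟨g, rfl⟩ := Abelian.Ext.addEquiv₀.symm.surjective e2
  change (Abelian.Ext.mk₀ g).comp _ _ = _ at he
  rw [Abelian.Ext.mk₀_comp_mk₀] at he
  have he := Abelian.Ext.addEquiv₀.symm.injective he
  have hg : g.hom (Submodule.Quotient.mk (1:R)) = 0 := h0 _ s (q_kill g)
  have h3 := congrArg (fun z => z.hom (Submodule.Quotient.mk (1:R))) he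
  have h4 : (π a hs ≫ f).hom (Submodule.Quotient.mk (1:R)) = q := hf
  rw [← h4]
  refine h3.symm.trans ?_
  change S.g.hom (g.hom _) = 0
  rw [hg, map_zero]

open scoped Pointwise in
lemma main [IsNoetherianRing R] (a : Ideal R) (hJac : a ≤ (⊥ : Ideal R).jacobson) (I : Ideal R) :
    ∀ (M : Type u) [AddCommGroup M] [Module R M] [Module.Finite R M], Module.annihilator R M = I →
      (∀ n, Vanish a (n+1) (ModuleCat.of R M)) → Tor a M := by
  induction I using WellFoundedGT.induction with
  | ind I ih =>
  intro M _ _ _ hI hv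
  let N := M ⧸ Gam a M
  obtain ⟨k, hk⟩ := unif (Gam a M) (IsNoetherian.noetherian _) le_rfl
  have h0 : ∀ y : N, ∀ n : ℕ, (∀ r ∈ a ^ n, r • y = 0) → y = 0 := by
    intro y n hy
    obtain ⟨m, rfl⟩ := Submodule.Quotient.mk_surjective _ y
    rw [Submodule.Quotient.mk_eq_zero]
    refine ⟨k + n, fun r hr => ?_⟩
    rw [pow_add] at hr
    refine Submodule.mul_induction_on hr ?_ ?_
    · intro b hb c hc
      rw [mul_smul]
      refine hk b hb _ ?_
      rw [← Submodule.Quotient.mk_eq_zero]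
      exact hy c hc
    · intro b c hb hc
      rw [add_smul, hb, hc, add_zero]
  have hvN : ∀ n, Vanish a (n+1) (ModuleCat.of R N) := by
    let S := ModuleCat.shortComplexOfCompEqZero (Gam a M).subtype (Gam a M).mkQ (by ext; simp)
    have hS : S.ShortExact :=
      { exact := ModuleCat.shortComplex_exact _ (LinearMap.exact_subtype_mkQ _)
        mono_f := (ModuleCat.mono_iff_injective _).mpr (Submodule.injective_subtype _)
        epi_g := (ModuleCat.epi_iff_surjective _).mpr (Submodule.mkQ_surjective _) }
    exact fun n => vanish₃ a hS (hv n) (vanish_tor a (n+1) _ (tor_gam a M))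
  obtain ⟨x, hxa, hx⟩ := exists_regular a N (fun y hy => h0 y 1 (by simpa using hy))
  have hN : ∀ y : N, y = 0 := by
    by_contra! hne
    obtain ⟨y, hy⟩ := hne
    let C := N ⧸ (x • (⊤ : Submodule R N))
    let p : N →ₗ[R] C := Submodule.mkQ _
    have hS := IsSMulRegular.smulShortComplex_shortExact (M := ModuleCat.of R N) hx
    have hsurj : Function.Surjective p := Submodule.mkQ_surjective _
    have hvC : ∀ n, Vanish a (n+1) (ModuleCat.of R C) := fun n => vanish₃ a hS (hvN n) (hvN (n+1))
    have hfin : Module.Finite R C := Module.Finite.of_surjective _ hsurj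
    have hxC : ∀ c : C, x • c = 0 := by
      intro c
      obtain ⟨z, rfl⟩ := hsurj c
      rw [← map_smul]
      exact (Submodule.Quotient.mk_eq_zero _).mpr (Submodule.smul_mem_pointwise_smul z x ⊤ trivial)
    have hlt : I < Module.annihilator R C := by
      refine lt_of_le_of_ne ?_ ?_
      · intro r hr
        rw [← hI, Module.mem_annihilator] at hr
        rw [Module.mem_annihilator]
        intro c
        obtain ⟨z, rfl⟩ := hsurj c
        obtain ⟨m, rfl⟩ := Submodule.Quotient.mk_surjective _ z
        rw [← map_smul]
        exact (congrArg (fun w => p (Submodule.Quotient.mk w)) (hr m)).trans (map_zero p)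
      · intro heq
        have : x ∈ I := by
          rw [heq, Module.mem_annihilator]; exact hxC
        rw [← hI, Module.mem_annihilator] at this
        apply hy
        apply hx
        obtain ⟨m, rfl⟩ := Submodule.Quotient.mk_surjective _ y
        change x • _ = x • _
        rw [smul_zero, ← Submodule.Quotient.mk_smul, this m]
        rfl
    have htor : Tor a C := ih _ hlt C rfl hvC
    have hC : ∀ c : C, c = 0 := fun c => by
      obtain ⟨t, ht⟩ := htor c
      exact quot_zero a hS h0 (hvN 0) c t ht
    have hbot : (⊤ : Submodule R N) = ⊥ := by
      refine Submodule.eq_bot_of_le_smul_of_le_jacobson_bot a ⊤ Module.Finite.fg_top ?_ hJac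
      intro z _
      have := hC (p z)
      have hz := (Submodule.Quotient.mk_eq_zero _).mp this
      rw [Submodule.mem_smul_pointwise_iff_exists] at hz
      obtain ⟨w, _, rfl⟩ := hz
      exact Submodule.smul_mem_smul hxa trivial
    exact hy (by simpa [hbot] using (Submodule.mem_top : y ∈ (⊤ : Submodule R N)))
  intro m
  exact (Submodule.Quotient.mk_eq_zero (Gam a M)).mp (hN (Submodule.Quotient.mk m))

end LC

/-- if `a` is in the Jacobson radical and all higher local cohomology of
`M` with respect to `a` vanishes, then `M` is `a`-torsion. -/
theorem stmt3 [IsNoetherianRing R] (a : Ideal R)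
    (hJac : a ≤ (⊥ : Ideal R).jacobson)
    (M : Type u) [AddCommGroup M] [Module R M] [Module.Finite R M] [Nontrivial M]
    (hcd : ∀ i : ℕ, 0 < i → Subsingleton (localCoh R a i M)) :
    ∀ m : M, ∃ n : ℕ, ∀ r ∈ a ^ n, r • m = 0 := by
  exact LC.main a hJac _ M rfl fun n => LC.vanish_of_localCoh a n M (hcd (n+1) (Nat.succ_pos n))
end

section
/- Let 𝔞 be an ideal of R contained in its Jacobson radical and M, N nonzero finitely generated R-modules. Assume N is 𝔞-relative Cohen-Macaulay and cd(𝔞,N) = ara(𝔞,N). Then Ext^i_R(N,M) = 0 for all i < grade(𝔞,M) − cd(𝔞,N). -/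
open CategoryTheory Opposite
open scoped TensorProduct

universe u

variable (R : Type u) [CommRing R]

section helpers
open Limits

variable {R}

/-- Comparison of the two versions of Ext, for vanishing. -/
lemma ext_cmp (X Y : ModuleCat.{u} R) (n : ℕ) :
    Subsingleton (((Ext R (ModuleCat.{u} R) n).obj (op X)).obj Y) ↔
      Subsingleton (Abelian.Ext X Y n) := by
  let P := projectiveResolution X
  rw [← ModuleCat.isZero_iff_subsingleton, (P.isoExt (R := R) n Y).isZero_iff,
    ← HomologicalComplex.exactAt_iff_isZero_homology]
  cases n with
  | zero =>
    rw [HomologicalComplex.exactAt_iff' _ 0 0 1 (by simp) (by simp),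
      ShortComplex.moduleCat_exact_iff]
    rw [Abelian.Ext.addEquiv₀.toEquiv.subsingleton_congr]
    let p : P.complex.X 0 ⟶ X := P.π.f 0
    have hpe : Epi p := inferInstanceAs (Epi (P.π.f 0))
    have hp : P.complex.d 1 0 ≫ p = 0 := P.complex_d_comp_π_f_zero
    constructor
    · intro h
      refine ⟨fun f g => ?_⟩
      have h1 : P.complex.d 1 0 ≫ (p ≫ (f - g)) = 0 := by
        rw [← Category.assoc, hp, zero_comp]
      obtain ⟨y, hy⟩ := h (p ≫ (f - g)) h1
      have hy2 : ∀ y' : P.complex.X 0 ⟶ Y, P.complex.d 0 0 ≫ y' = p ≫ (f - g) → f = g := by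
        intro y' hy'
        rw [P.complex.shape 0 0 (by simp), zero_comp, eq_comm] at hy'
        exact sub_eq_zero.1 (zero_of_epi_comp p hy')
      exact hy2 y hy
    · intro h f hf
      have key : ∀ f' : P.complex.X 0 ⟶ Y, P.complex.d 1 0 ≫ f' = 0 → f' = 0 := by
        intro f' hf'
        let k : X ⟶ Y := P.isColimitCokernelCofork.desc (CokernelCofork.ofπ f' hf')
        have hk : p ≫ k = f' :=
          P.isColimitCokernelCofork.fac (CokernelCofork.ofπ f' hf') WalkingParallelPair.one
        rw [← hk, show k = 0 from Subsingleton.elim _ _, comp_zero]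
      refine ⟨0, ?_⟩
      rw [map_zero]
      exact (key f hf).symm
  | succ n =>
    rw [HomologicalComplex.exactAt_iff' _ n (n+1) (n+2) (by simp) (by simp),
      ShortComplex.moduleCat_exact_iff]
    constructor
    · intro h
      refine ⟨fun α β => ?_⟩
      have : ∀ α : Abelian.Ext X Y (n+1), α = 0 := by
        intro α
        obtain ⟨f, hf, rfl⟩ := P.extMk_surjective α (n+2) rfl
        rw [P.extMk_eq_zero_iff _ _ _ _ n rfl]
        exact h f hf
      rw [this α, this β]
    · intro h f hf
      have hf' : P.complex.d (n+2) (n+1) ≫ (f : P.complex.X (n+1) ⟶ Y) = 0 := hf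
      exact (P.extMk_eq_zero_iff f (n+2) rfl hf' n rfl).1 (Subsingleton.elim _ _)

end helpers

section helpers2
open scoped Pointwise
variable {R}
variable {A B C : Type u} [AddCommGroup A] [Module R A] [AddCommGroup B] [Module R B]
  [AddCommGroup C] [Module R C]

/-- Vanishing of `Ext^i(N,M)`. -/
def VE (R : Type u) [CommRing R] (M N : Type u) [AddCommGroup M] [Module R M]
    [AddCommGroup N] [Module R N] (i : ℕ) : Prop :=
  ∀ e : Abelian.Ext (ModuleCat.of R N) (ModuleCat.of R M) i, e = 0

lemma mkSE (f : A →ₗ[R] B) (g : B →ₗ[R] C) (hf : Function.Injective f)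
    (hg : Function.Surjective g) (h : Function.Exact f g) :
    (ShortComplex.mk (ModuleCat.ofHom f) (ModuleCat.ofHom g)
      (by ext x; exact h.apply_apply_eq_zero x)).ShortExact where
  exact := by
    rw [ShortComplex.ShortExact.moduleCat_exact_iff_function_exact]
    exact h
  mono_f := (ModuleCat.mono_iff_injective _).2 hf
  epi_g := (ModuleCat.epi_iff_surjective _).2 hg

variable (M : Type u) [AddCommGroup M] [Module R M]

lemma VE.mid (f : A →ₗ[R] B) (g : B →ₗ[R] C) (hf : Function.Injective f)
    (hg : Function.Surjective g) (h : Function.Exact f g) (i : ℕ)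
    (hA : VE R M A i) (hC : VE R M C i) : VE R M B i := by
  intro e
  obtain ⟨x, rfl⟩ := Abelian.Ext.contravariant_sequence_exact₂ (mkSE f g hf hg h) _ e (hA _)
  rw [show x = 0 from hC x, Abelian.Ext.comp_zero]

lemma VE.right (f : A →ₗ[R] B) (g : B →ₗ[R] C) (hf : Function.Injective f)
    (hg : Function.Surjective g) (h : Function.Exact f g) (i : ℕ)
    (hA : VE R M A i) (hB : VE R M B (i+1)) : VE R M C (i+1) := by
  intro e
  obtain ⟨x, rfl⟩ := Abelian.Ext.contravariant_sequence_exact₃ (mkSE f g hf hg h) _ e (hB _)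
    (add_comm 1 i)
  rw [show x = 0 from hA x, Abelian.Ext.comp_zero]

lemma VE.right0 (g : B →ₗ[R] C) (hg : Function.Surjective g)
    (hB : VE R M B 0) : VE R M C 0 := by
  intro e
  have : Epi (ModuleCat.ofHom g) := (ModuleCat.epi_iff_surjective _).2 hg
  apply Abelian.Ext.precomp_mk₀_injective_of_epi _ (ModuleCat.ofHom g)
  rw [map_zero]
  exact hB _

lemma VE.zero [Subsingleton A] (i : ℕ) : VE R M A i := by
  intro e
  rw [← Abelian.Ext.mk₀_id_comp e]
  have : (𝟙 (ModuleCat.of R A)) = 0 := by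
    ext x; exact Subsingleton.elim (α := A) _ _
  rw [this, Abelian.Ext.mk₀_zero, Abelian.Ext.zero_comp]

lemma VE.divis (N : Type u) [AddCommGroup N] [Module R N] (x : R) (hx : IsSMulRegular N x) (i : ℕ)
    (hA : VE R M (QuotSMulTop x N) (i+1))
    (e : Abelian.Ext (ModuleCat.of R N) (ModuleCat.of R M) i) :
    ∃ e', x • e' = e := by
  have hse := mkSE (LinearMap.lsmul R N x) (Submodule.mkQ (x • (⊤ : Submodule R N))) hx
    (Submodule.mkQ_surjective _) (by
      rw [LinearMap.exact_iff, Submodule.ker_mkQ]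
      ext y
      simp [Submodule.mem_smul_pointwise_iff_exists])
  obtain ⟨e', rfl⟩ := Abelian.Ext.contravariant_sequence_exact₁ hse _ e (add_comm 1 i) (hA _)
  refine ⟨e', ?_⟩
  have : ModuleCat.ofHom (LinearMap.lsmul R N x) = x • 𝟙 (ModuleCat.of R N) := by
    ext; rfl
  change _ = (Abelian.Ext.mk₀ (ModuleCat.ofHom (LinearMap.lsmul R N x))).comp e' _
  rw [this, Abelian.Ext.mk₀_smul, Abelian.Ext.smul_comp, Abelian.Ext.mk₀_id_comp]

lemma VE.annih (N : Type u) [AddCommGroup N] [Module R N] (x : R)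
    (hx : x ∈ Module.annihilator R N) (i : ℕ)
    (e : Abelian.Ext (ModuleCat.of R N) (ModuleCat.of R M) i) : x • e = 0 := by
  have : x • 𝟙 (ModuleCat.of R N) = 0 := by
    ext y
    exact Module.mem_annihilator.1 hx y
  rw [← Abelian.Ext.mk₀_id_comp (x • e), Abelian.Ext.comp_smul, ← Abelian.Ext.smul_comp,
    ← Abelian.Ext.mk₀_smul, this, Abelian.Ext.mk₀_zero, Abelian.Ext.zero_comp]

lemma VE.pi (I : Ideal R) (i : ℕ) (h : VE R M (R ⧸ I) i) (n : ℕ) :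
    VE R M (Fin n → R ⧸ I) i := by
  induction n with
  | zero => exact VE.zero M i
  | succ n ih =>
    refine VE.mid M (LinearMap.single R (fun _ : Fin (n+1) => R ⧸ I) 0)
      (LinearMap.funLeft R (R ⧸ I) Fin.succ) (Pi.single_injective (M := fun _ : Fin (n+1) => R ⧸ I) 0)
      (LinearMap.funLeft_surjective_of_injective _ _ _ (Fin.succ_injective n)) ?_ i h ih
    intro y
    constructor
    · intro hy
      refine ⟨y 0, ?_⟩
      ext j
      refine Fin.cases ?_ (fun j => ?_) j
      · simp
      · have := congrFun hy j
        simpa [LinearMap.funLeft] using this.symm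
    · rintro ⟨z, rfl⟩
      ext j
      simp [LinearMap.funLeft]

variable [IsNoetherianRing R] (I : Ideal R)

lemma VE.killed (g : ℕ) (h : ∀ j < g, VE R M (R ⧸ I) j) (j : ℕ) (hj : j < g)
    (N : Type u) [AddCommGroup N] [Module R N] [Module.Finite R N]
    (hN : I ≤ Module.annihilator R N) : VE R M N j := by
  induction j generalizing N with
  | zero =>
    have ht : Module.IsTorsionBySet R N I := fun x a => Module.mem_annihilator.1 (hN a.2) x
    let := ht.module
    have : IsScalarTower R (R ⧸ I) N := ht.isScalarTower
    have : Module.Finite (R ⧸ I) N := Module.Finite.of_restrictScalars_finite R _ _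
    obtain ⟨n, f, hf⟩ := Module.Finite.exists_fin' (R ⧸ I) N
    exact VE.right0 M (f.restrictScalars R) hf (VE.pi M I 0 (h 0 hj) n)
  | succ j ih =>
    have ht : Module.IsTorsionBySet R N I := fun x a => Module.mem_annihilator.1 (hN a.2) x
    let := ht.module
    have : IsScalarTower R (R ⧸ I) N := ht.isScalarTower
    have : Module.Finite (R ⧸ I) N := Module.Finite.of_restrictScalars_finite R _ _
    obtain ⟨n, f, hf⟩ := Module.Finite.exists_fin' (R ⧸ I) N
    let f' := f.restrictScalars R
    refine VE.right M (LinearMap.ker f').subtype f' (Submodule.subtype_injective _) hf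
      (LinearMap.exact_subtype_ker_map f') j (ih (by omega) _ ?_) (VE.pi M I _ (h _ hj) n)
    intro a ha
    rw [Module.mem_annihilator]
    rintro ⟨y, hy⟩
    ext k
    obtain ⟨r, hr⟩ := Ideal.Quotient.mk_surjective (y k)
    change a • y k = 0
    rw [← hr, Algebra.smul_def, Ideal.Quotient.algebraMap_eq, Ideal.Quotient.eq_zero_iff_mem.2 ha,
      zero_mul]

lemma VE.killed_pow (g : ℕ) (h : ∀ j < g, VE R M (R ⧸ I) j) (j : ℕ) (hj : j < g) (k : ℕ)
    (N : Type u) [AddCommGroup N] [Module R N] [Module.Finite R N]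
    (hN : I ^ k ≤ Module.annihilator R N) : VE R M N j := by
  induction k generalizing N with
  | zero =>
    have : Subsingleton N := by
      rw [← Module.annihilator_eq_top_iff (R := R)]
      simpa using hN
    exact VE.zero M j
  | succ k ih =>
    refine VE.mid M (I • (⊤ : Submodule R N)).subtype (Submodule.mkQ _)
      (Submodule.subtype_injective _) (Submodule.mkQ_surjective _)
      (LinearMap.exact_subtype_mkQ _) j (ih _ ?_) (VE.killed M I g h j hj _ ?_)
    · intro a ha
      rw [Module.mem_annihilator]
      rintro ⟨y, hy⟩
      ext
      change a • y = 0
      refine Submodule.smul_induction_on hy ?_ ?_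
      · intro r hr n _
        rw [← mul_smul]
        exact Module.mem_annihilator.1 (hN (by rw [pow_succ]; exact Ideal.mul_mem_mul ha hr)) n
      · intro x y hx hy
        rw [smul_add, hx, hy, add_zero]
    · intro a ha
      rw [Module.mem_annihilator]
      intro y
      obtain ⟨y, rfl⟩ := Submodule.mkQ_surjective _ y
      rw [← map_smul, Submodule.mkQ_apply, Submodule.Quotient.mk_eq_zero]
      exact Submodule.smul_mem_smul ha trivial

lemma VE.main (hJ : I ≤ (⊥ : Ideal R).jacobson) [Module.Finite R M]
    (g : ℕ) (h : ∀ j < g, VE R M (R ⧸ I) j) (l : List R)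
    (N : Type u) [AddCommGroup N] [Module R N] [Module.Finite R N]
    (hl : ∀ x ∈ l, x ∈ (I ⊔ Module.annihilator R N).radical)
    (hI : I ≤ (Ideal.ofList l ⊔ Module.annihilator R N).radical)
    (i : ℕ) (hi : i + l.length < g) : VE R M N i := by
  induction l generalizing N i with
  | nil =>
    rw [Ideal.ofList_nil, bot_sup_eq] at hI
    obtain ⟨k, hk⟩ := Ideal.exists_pow_le_of_le_radical_of_fg hI (IsNoetherian.noetherian I)
    exact VE.killed_pow M I g h i (by simpa using hi) k N hk
  | cons x l ih =>
    have key : ∀ (N' : Type u) [AddCommGroup N'] [Module R N'] [Module.Finite R N'] (k : ℕ),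
        Module.annihilator R N ≤ Module.annihilator R N' → x ^ k ∈ Module.annihilator R N' →
        ∀ i, i + l.length < g → VE R M N' i := by
      intro N' _ _ _ k h1 h2 i hi
      refine ih N' ?_ ?_ i hi
      · intro y hy
        exact Ideal.radical_mono (sup_le_sup_left h1 _) (hl y (List.mem_cons_of_mem _ hy))
      · refine hI.trans ?_
        rw [Ideal.radical_le_radical_iff, Ideal.ofList_cons]
        refine sup_le (sup_le ?_ ?_) ?_
        · rw [Ideal.span_singleton_le_iff_mem]
          exact ⟨k, Ideal.mem_sup_right h2⟩
        · exact le_sup_left.trans Ideal.le_radical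
        · exact (h1.trans le_sup_right).trans Ideal.le_radical
    rw [List.length_cons] at hi
    obtain ⟨k, hk⟩ := monotone_stabilizes_iff_noetherian.mpr (inferInstance : IsNoetherian R N)
      ⟨fun k => Submodule.torsionBy R N (x ^ k), fun k m hkm =>
        Submodule.torsionBy_le_torsionBy_of_dvd _ _ (pow_dvd_pow x hkm)⟩
    have hk1 : Submodule.torsionBy R N (x ^ k) = Submodule.torsionBy R N (x ^ (k+1)) :=
      hk (k+1) (by omega)
    set T := Submodule.torsionBy R N (x ^ k) with hT
    have hAQ : Module.annihilator R N ≤ Module.annihilator R (N ⧸ T) :=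
      LinearMap.annihilator_le_of_surjective _ (Submodule.mkQ_surjective T)
    refine VE.mid M T.subtype T.mkQ T.subtype_injective T.mkQ_surjective
      (LinearMap.exact_subtype_mkQ _) i (key _ k ?_ ?_ i (by omega)) ?_
    · exact LinearMap.annihilator_le_of_injective _ T.subtype_injective
    · rw [Module.mem_annihilator]
      exact Submodule.smul_torsionBy _
    · have hreg : IsSMulRegular (N ⧸ T) x := by
        rw [isSMulRegular_iff_right_eq_zero_of_smul]
        intro y hy
        obtain ⟨y, rfl⟩ := Submodule.mkQ_surjective _ y
        rw [← map_smul, Submodule.mkQ_apply, Submodule.Quotient.mk_eq_zero, hT,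
          Submodule.mem_torsionBy_iff, ← mul_smul, ← pow_succ, ← Submodule.mem_torsionBy_iff,
          ← hk1] at hy
        rwa [Submodule.mkQ_apply, Submodule.Quotient.mk_eq_zero]
      have hdiv : ∀ e : Abelian.Ext (ModuleCat.of R (N ⧸ T)) (ModuleCat.of R M) i,
          ∃ e', x • e' = e := by
        refine VE.divis M (N ⧸ T) x hreg i (key _ 1 ?_ ?_ (i+1) (by omega))
        · exact hAQ.trans (LinearMap.annihilator_le_of_surjective _ (Submodule.mkQ_surjective _))
        · rw [pow_one, Module.mem_annihilator]
          intro y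
          obtain ⟨y, rfl⟩ := Submodule.mkQ_surjective _ y
          rw [← map_smul, Submodule.mkQ_apply, Submodule.Quotient.mk_eq_zero]
          exact Submodule.smul_mem_pointwise_smul _ _ _ trivial
      have hdivp : ∀ (m : ℕ) (e : Abelian.Ext (ModuleCat.of R (N ⧸ T)) (ModuleCat.of R M) i),
          ∃ e', x ^ m • e' = e := by
        intro m
        induction m with
        | zero => exact fun e => ⟨e, by simp⟩
        | succ m ihm =>
          intro e
          obtain ⟨e1, rfl⟩ := ihm e
          obtain ⟨e2, rfl⟩ := hdiv e1
          exact ⟨e2, by rw [pow_succ, mul_smul]⟩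
      obtain ⟨m, hm⟩ := hl x (List.mem_cons_self)
      obtain ⟨α, hα, β, hβ, hab⟩ := Submodule.mem_sup.1 hm
      have hfin : Module.Finite R (Abelian.Ext (ModuleCat.of R (N ⧸ T)) (ModuleCat.of R M) i) :=
        ModuleCat.finite_ext R _ _ i
      have hbot := Submodule.eq_bot_of_le_smul_of_le_jacobson_bot I
        (⊤ : Submodule R (Abelian.Ext (ModuleCat.of R (N ⧸ T)) (ModuleCat.of R M) i))
        hfin.fg_top (by
          intro e _
          obtain ⟨e', rfl⟩ := hdivp m e
          rw [← hab, add_smul, VE.annih M _ β (hAQ hβ), add_zero]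
          exact Submodule.smul_mem_smul hα trivial) hJ
      intro e
      exact (Submodule.mem_bot R).1 (hbot ▸ (trivial : e ∈ (⊤ : Submodule R _)))

end helpers2

/-- vanishing of `Ext^i(N, M)` for `i < grade(a,M) - cd(a,N)` when `N` is
`a`-relative Cohen-Macaulay with `cd(a,N) = ara(a,N)` and `a` is in the Jacobson radical. -/
theorem stmt5 [IsNoetherianRing R] (a : Ideal R)
    (hJac : a ≤ (⊥ : Ideal R).jacobson)
    (M : Type u) [AddCommGroup M] [Module R M] [Module.Finite R M] [Nontrivial M]
    (N : Type u) [AddCommGroup N] [Module R N] [Module.Finite R N] [Nontrivial N]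
    (hCM : IsRelCM R a N) (hara : rcd R a N = ara R a N) :
    ∀ i : ℕ, i + rcd R a N < rgrade R a M →
      Subsingleton (((Ext R (ModuleCat R) i).obj
        (op (ModuleCat.of R N))).obj (ModuleCat.of R M)) := by
  intro i hi
  rw [ext_cmp]
  have h1 : ∀ j < rgrade R a M, VE R M (R ⧸ a) j := by
    intro j hj e
    have h2 := Nat.notMem_of_lt_sInf hj
    have h3 : Subsingleton (relExt R a j M) := not_nontrivial_iff_subsingleton.1 h2
    have h4 := (ext_cmp (ModuleCat.of R (R ⧸ a)) (ModuleCat.of R M) j).1 h3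
    exact Subsingleton.elim _ _
  have hne : {n | ∃ x : Fin n → R,
      (Ideal.span (Set.range x) + Module.annihilator R N).radical
        = (a + Module.annihilator R N).radical}.Nonempty := by
    obtain ⟨n, x, hx⟩ := Submodule.fg_iff_exists_fin_generating_family.1
      (IsNoetherian.noetherian a)
    refine ⟨n, x, ?_⟩
    rw [show Ideal.span (Set.range x) = a from hx]
  obtain ⟨x, hx⟩ := Nat.sInf_mem hne
  have hlen : (List.ofFn x).length = rcd R a N := by
    rw [List.length_ofFn, hara]; rfl
  have hof : Ideal.ofList (List.ofFn x) = Ideal.span (Set.range x) := by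
    unfold Ideal.ofList
    congr 1
    ext y
    simp [List.mem_ofFn]
  change (Ideal.span (Set.range x) ⊔ Module.annihilator R N).radical
    = (a ⊔ Module.annihilator R N).radical at hx
  have h5 := VE.main M a hJac (rgrade R a M) h1 (List.ofFn x) N
    (by
      intro y hy
      rw [← hx, ← hof]
      exact Ideal.le_radical (Ideal.mem_sup_left (Ideal.subset_span hy)))
    (by
      rw [hof, hx]
      exact le_sup_left.trans Ideal.le_radical) i (by rw [hlen]; exact hi)
  exact ⟨fun e e' => by rw [h5 e, h5 e']⟩
end
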